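/- Let n ≥ 5 be an odd integer and a a nonzero integer. Let 𝒫 ⊂ ℤ² be an infinite set of pairs (b,c) ≠ (0,0) such that for any two distinct elements (b,c), (b′,c′) of 𝒫 the points [b : c] and [b′ : c′] of the projective line ℙ¹(ℚ) are distinct. For each (n−3)/2-tuple v = ((b_j, c_j))_{1 ≤ j ≤ (n−3)/2} ∈ 𝒫^{(n−3)/2}, let C(a, v) be the plane projective curve defined by (X³ + a Y³)·∏_{j=1}^{(n−3)/2}(b_j²X² + b_j c_j XY + c_j²Y²) = Z^n. Then the set { C(a, v) : v ∈ 𝒫^{(n−3)/2} } contains infinitely many non-singular curves that are pairwise non-isomorphic as algebraic curves over ℂ. -/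

import Mathlib

open MvPolynomial

/-- The homogeneous polynomial `(X³+aY³) ∏_j (b_j²X² + b_j c_j XY + c_j² Y²) - Z^n`
over `ℂ`, where `bc j = (b_j, c_j)`. -/
noncomputable def curvePoly (a : ℤ) (n : ℕ) {m : ℕ} (bc : Fin m → ℤ × ℤ) :
    MvPolynomial (Fin 3) ℂ :=
  (X 0 ^ 3 + C (a : ℂ) * X 1 ^ 3) *
      ∏ j : Fin m, (C (((bc j).1 : ℂ)) ^ 2 * X 0 ^ 2
        + C (((bc j).1 : ℂ)) * C (((bc j).2 : ℂ)) * X 0 * X 1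
        + C (((bc j).2 : ℂ)) ^ 2 * X 1 ^ 2)
    - X 2 ^ n

/-- A homogeneous polynomial `F` defines a non-singular plane projective curve:
`F` and its partial derivatives have no common zero other than the origin over `ℂ`. -/
def IsNonsingular (F : MvPolynomial (Fin 3) ℂ) : Prop :=
  ∀ v : Fin 3 → ℂ, v ≠ 0 →
    ¬ (eval v F = 0 ∧ ∀ i : Fin 3, eval v (pderiv i F) = 0)

/-- Dehomogenization at `Z = 1` of the defining polynomial of the curve `C(a, bc)`. -/
noncomputable def affinePoly (a : ℤ) {m : ℕ} (bc : Fin m → ℤ × ℤ) :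
    MvPolynomial (Fin 2) ℂ :=
  (X 0 ^ 3 + C (a : ℂ) * X 1 ^ 3) *
      ∏ j : Fin m, (C (((bc j).1 : ℂ)) ^ 2 * X 0 ^ 2
        + C (((bc j).1 : ℂ)) * C (((bc j).2 : ℂ)) * X 0 * X 1
        + C (((bc j).2 : ℂ)) ^ 2 * X 1 ^ 2)
    - 1

/-- The function field over `ℂ` of the plane curve whose (irreducible) dehomogenized
defining polynomial is `f`. -/
noncomputable abbrev FunctionFieldOf (f : MvPolynomial (Fin 2) ℂ) : Type :=
  FractionRing (MvPolynomial (Fin 2) ℂ ⧸ Ideal.span {f})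

/-- Two non-singular projective plane curves over `ℂ`, given by the dehomogenized
defining polynomials `f` and `g`, are isomorphic as algebraic curves over `ℂ`
if and only if their function fields are isomorphic as `ℂ`-algebras. -/
def CurvesIsomorphic (f g : MvPolynomial (Fin 2) ℂ) : Prop :=
  Nonempty (FunctionFieldOf f ≃ₐ[ℂ] FunctionFieldOf g)

/-- The field of formal Laurent series over `ℂ`. -/
abbrev FormalLaurent : Type := FractionRing (PowerSeries ℂ)

namespace FormalLaurent

/-- The ring of formal power series inside the field of Laurent series. -/
noncomputable def integers : Subalgebra ℂ FormalLaurent :=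
  (IsScalarTower.toAlgHom ℂ (PowerSeries ℂ) FormalLaurent).range

/-- The uniformizer. -/
noncomputable def π : FormalLaurent := algebraMap (PowerSeries ℂ) FormalLaurent PowerSeries.X

theorem mem_integers {x : FormalLaurent} :
    x ∈ integers ↔ ∃ p : PowerSeries ℂ, algebraMap (PowerSeries ℂ) FormalLaurent p = x :=
  Iff.rfl

theorem π_mem : π ∈ integers := ⟨_, rfl⟩

theorem π_ne_zero : π ≠ 0 := by
  simp [π, PowerSeries.X_ne_zero]

theorem algebraMap_mem (c : ℂ) : algebraMap ℂ FormalLaurent c ∈ integers :=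
  integers.algebraMap_mem c

/-- A constant divisible by the uniformizer vanishes. -/
theorem eq_zero_of_eq_π_mul {c : ℂ} {x : FormalLaurent} (hx : x ∈ integers)
    (h : algebraMap ℂ FormalLaurent c = π * x) : c = 0 := by
  obtain ⟨p, rfl⟩ := mem_integers.1 hx
  rw [IsScalarTower.algebraMap_apply ℂ (PowerSeries ℂ) FormalLaurent, π, ← map_mul] at h
  have h2 := IsFractionRing.injective (PowerSeries ℂ) FormalLaurent h
  have h3 := congrArg PowerSeries.constantCoeff h2
  simpa [PowerSeries.algebraMap_apply] using h3

theorem exists_eq_add_π_mul {x : FormalLaurent} (hx : x ∈ integers) :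
    ∃ (c : ℂ) (y : FormalLaurent), y ∈ integers ∧ x = algebraMap ℂ FormalLaurent c + π * y := by
  obtain ⟨p, rfl⟩ := mem_integers.1 hx
  refine ⟨PowerSeries.constantCoeff p,
    algebraMap _ _ (PowerSeries.mk fun n ↦ PowerSeries.coeff (n + 1) p), ⟨_, rfl⟩, ?_⟩
  rw [IsScalarTower.algebraMap_apply ℂ (PowerSeries ℂ) FormalLaurent, π, ← map_mul, ← map_add]
  congr 1
  conv_lhs => rw [PowerSeries.eq_X_mul_shift_add_const p]
  rw [add_comm]
  rfl

theorem mem_or_inv_mem (x : FormalLaurent) : x ∈ integers ∨ x⁻¹ ∈ integers := by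
  rcases ValuationRing.isInteger_or_isInteger (PowerSeries ℂ) x with h | h
  · exact Or.inl h
  · exact Or.inr h

/-- An integral element with nonzero residue is a unit. -/
theorem inv_mem {c : ℂ} (hc : c ≠ 0) {y : FormalLaurent} (hy : y ∈ integers) :
    (algebraMap ℂ FormalLaurent c + π * y)⁻¹ ∈ integers := by
  obtain ⟨p, rfl⟩ := mem_integers.1 hy
  rw [IsScalarTower.algebraMap_apply ℂ (PowerSeries ℂ) FormalLaurent, π, ← map_mul, ← map_add]
  have hu : IsUnit (algebraMap ℂ (PowerSeries ℂ) c + PowerSeries.X * p) := by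
    rw [PowerSeries.isUnit_iff_constantCoeff]
    simpa [PowerSeries.algebraMap_apply] using hc
  obtain ⟨u, hu⟩ := hu
  rw [← hu]
  exact ⟨(↑u⁻¹ : PowerSeries ℂ), by
    change algebraMap _ _ _ = _
    refine eq_inv_of_mul_eq_one_left ?_
    rw [← map_mul]; simp⟩

/-- If neither `x` nor its inverse has a pole, `x` has nonzero residue; otherwise `x⁻¹` vanishes. -/
theorem inv_eq_π_mul {x : FormalLaurent} (hx : x ∉ integers) :
    ∃ y ∈ integers, x⁻¹ = π * y := by
  have h := (mem_or_inv_mem x).resolve_left hx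
  obtain ⟨c, y, hy, e⟩ := exists_eq_add_π_mul h
  by_cases hc : c = 0
  · exact ⟨y, hy, by simpa [hc] using e⟩
  · exact absurd (by simpa [← e] using inv_mem hc hy) hx

theorem mem_of_pow_mem {x : FormalLaurent} {n : ℕ} (hn : n ≠ 0) (h : x ^ n ∈ integers) :
    x ∈ integers := by
  by_contra hx
  have hx0 : x ≠ 0 := fun h0 ↦ hx (h0 ▸ integers.zero_mem)
  have hi := (mem_or_inv_mem x).resolve_left hx
  obtain ⟨m, rfl⟩ := Nat.exists_eq_succ_of_ne_zero hn
  refine hx ?_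
  have := integers.mul_mem h (integers.pow_mem hi m)
  rwa [pow_succ, mul_right_comm, ← mul_pow, mul_inv_cancel₀ hx0, one_pow, one_mul] at this

/-- The ring homomorphism `p ↦ p + p' ε`. -/
noncomputable def dualHom : PowerSeries ℂ →+* TrivSqZeroExt FormalLaurent FormalLaurent where
  toFun p := TrivSqZeroExt.inl (algebraMap _ _ p) +
    TrivSqZeroExt.inr (algebraMap _ _ (PowerSeries.derivative ℂ p))
  map_one' := by ext <;> simp
  map_zero' := by ext <;> simp
  map_mul' p q := by
    ext
    · simp
    · simp only [TrivSqZeroExt.snd_add, TrivSqZeroExt.snd_mul, TrivSqZeroExt.snd_inl,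
        TrivSqZeroExt.snd_inr, TrivSqZeroExt.fst_add, TrivSqZeroExt.fst_inl,
        TrivSqZeroExt.fst_inr, Derivation.leibniz, map_add, map_mul, smul_eq_mul,
        MulOpposite.smul_eq_mul_unop, MulOpposite.unop_op, add_zero, zero_add]
      ring
  map_add' p q := by
    simp only [map_add, TrivSqZeroExt.inl_add, TrivSqZeroExt.inr_add]
    abel

theorem isUnit_dualHom (y : nonZeroDivisors (PowerSeries ℂ)) : IsUnit (dualHom y) := by
  rw [TrivSqZeroExt.isUnit_iff_isUnit_fst]
  simp [dualHom]

/-- The extension of `dualHom` to Laurent series. -/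
noncomputable def dualLift : FormalLaurent →+* TrivSqZeroExt FormalLaurent FormalLaurent :=
  IsLocalization.lift isUnit_dualHom

theorem dualLift_algebraMap (p : PowerSeries ℂ) : dualLift (algebraMap _ _ p) = dualHom p :=
  IsLocalization.lift_eq _ _

theorem fst_dualLift (x : FormalLaurent) : (dualLift x).fst = x := by
  have : ((TrivSqZeroExt.fstHom ℂ FormalLaurent FormalLaurent : _ →+* FormalLaurent).comp
      dualLift) = RingHom.id _ := by
    apply IsLocalization.ringHom_ext (nonZeroDivisors (PowerSeries ℂ))
    ext p
    simp [dualLift_algebraMap, dualHom]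
  exact DFunLike.congr_fun this x

theorem snd_dualLift_algebraMap (c : ℂ) : (dualLift (algebraMap ℂ FormalLaurent c)).snd = 0 := by
  rw [IsScalarTower.algebraMap_apply ℂ (PowerSeries ℂ) FormalLaurent, dualLift_algebraMap]
  simp [dualHom]

/-- Formal differentiation of Laurent series. -/
noncomputable def D : Derivation ℂ FormalLaurent FormalLaurent :=
  Derivation.mk'
    { toFun x := (dualLift x).snd
      map_add' x y := by simp
      map_smul' c x := by
        simp [Algebra.smul_def, snd_dualLift_algebraMap, fst_dualLift] }
    fun x y ↦ by simp [fst_dualLift, mul_comm]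

theorem D_algebraMap (p : PowerSeries ℂ) :
    D (algebraMap _ _ p) = algebraMap _ _ (PowerSeries.derivative ℂ p) := by
  change (dualLift _).snd = _
  rw [dualLift_algebraMap]
  simp only [dualHom, RingHom.coe_mk, MonoidHom.coe_mk, OneHom.coe_mk, TrivSqZeroExt.snd_add,
    TrivSqZeroExt.snd_inl, TrivSqZeroExt.snd_inr, zero_add]

theorem D_mem {x : FormalLaurent} (hx : x ∈ integers) : D x ∈ integers := by
  obtain ⟨p, rfl⟩ := mem_integers.1 hx
  exact ⟨_, (D_algebraMap p).symm⟩

theorem D_π : D π = 1 := by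
  simp [π, D_algebraMap]

theorem exists_root_one_add (n : ℕ) (hn : n ≠ 0) (c : ℂ) :
    ∃ R ∈ integers, R ^ n = 1 + algebraMap ℂ FormalLaurent c * π ^ n := by
  have hs : PowerSeries.HasSubst (PowerSeries.C c * PowerSeries.X ^ n : PowerSeries ℂ) := by
    apply PowerSeries.HasSubst.of_constantCoeff_zero
    change PowerSeries.constantCoeff _ = 0
    simp [hn]
  have hroot : (PowerSeries.binomialSeries ℂ ((n : ℚ)⁻¹)) ^ n = 1 + PowerSeries.X := by
    have h : ∀ k : ℕ, (PowerSeries.binomialSeries ℂ ((n : ℚ)⁻¹)) ^ k =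
        PowerSeries.binomialSeries ℂ ((k : ℚ) * (n : ℚ)⁻¹) := by
      intro k
      induction k with
      | zero => simp
      | succ k ih =>
        rw [pow_succ, ih, ← PowerSeries.binomialSeries_add]
        push_cast; ring_nf
    rw [h, mul_inv_cancel₀ (by exact_mod_cast hn)]
    simpa using PowerSeries.binomialSeries_nat (R := ℚ) (A := ℂ) 1
  refine ⟨_, ⟨PowerSeries.substAlgHom hs (PowerSeries.binomialSeries ℂ ((n : ℚ)⁻¹)), rfl⟩, ?_⟩
  change (algebraMap _ _ _) ^ n = _
  rw [← map_pow, ← map_pow, hroot, map_add, map_one, PowerSeries.substAlgHom_X,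
    IsScalarTower.algebraMap_apply ℂ (PowerSeries ℂ) FormalLaurent, π, ← map_pow, ← map_mul,
    map_add, map_one]
  rfl

theorem transcendental_of_D_ne_zero {T : FormalLaurent} (hT : D T ≠ 0) :
    Transcendental ℂ T := by
  intro h
  obtain ⟨c, rfl⟩ := (IsAlgClosed.algebraMap_bijective_of_isIntegral
    (k := ℂ) (K := integralClosure ℂ FormalLaurent)).2 ⟨T, h.isIntegral⟩ |>.imp
      fun c hc ↦ (congrArg Subtype.val hc)
  exact hT (D.map_algebraMap c)

end FormalLaurent

namespace Polynomial

/-- A binary form of degree `n` over `ℂ` with distinct roots, none of them at infinity. -/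
structure SplitForm (n : ℕ) where
  /-- The affine roots. -/
  roots : Finset ℂ
  card_roots : roots.card = n
  /-- The leading coefficient. -/
  lead : ℂ
  lead_ne_zero : lead ≠ 0

namespace SplitForm

variable {n : ℕ} (B : SplitForm n)

/-- The dehomogenization of the form. -/
noncomputable def poly : ℂ[X] := C B.lead * ∏ s ∈ B.roots, (X - C s)

theorem natDegree_poly : B.poly.natDegree = n := by
  rw [poly, natDegree_C_mul B.lead_ne_zero, natDegree_finsetProd_X_sub_C_eq_card, B.card_roots]

theorem poly_ne_zero : B.poly ≠ 0 :=
  mul_ne_zero (C_ne_zero.2 B.lead_ne_zero)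
    (Finset.prod_ne_zero_iff.2 fun s _ ↦ X_sub_C_ne_zero s)

theorem separable_poly : B.poly.Separable := by
  refine Separable.unit_mul (isUnit_C.2 B.lead_ne_zero.isUnit) ?_
  exact separable_prod_X_sub_C_iff' .. |>.2 fun x _ y _ h ↦ h

/-- The Kummer polynomial `Z ^ n - B(t)` over `ℂ(t)`. -/
noncomputable def kummer : (RatFunc ℂ)[X] := X ^ n - C (algebraMap ℂ[X] (RatFunc ℂ) B.poly)

/-- The Kummer polynomial over `ℂ[t]`. -/
noncomputable def kummerInt : ℂ[X][X] := X ^ n - C B.poly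

theorem map_kummerInt : B.kummerInt.map (algebraMap ℂ[X] (RatFunc ℂ)) = B.kummer := by
  simp [kummerInt, kummer]

variable [NeZero n]

theorem monic_kummerInt : B.kummerInt.Monic := monic_X_pow_sub_C _ (NeZero.ne n)

theorem monic_kummer : B.kummer.Monic := monic_X_pow_sub_C _ (NeZero.ne n)

omit [NeZero n] in
theorem natDegree_kummer : B.kummer.natDegree = n := natDegree_X_pow_sub_C

theorem exists_root : ∃ s, s ∈ B.roots := by
  apply Finset.card_pos.1
  rw [B.card_roots]
  exact NeZero.pos n

theorem irreducible_kummerInt : Irreducible B.kummerInt := by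
  obtain ⟨s, hs⟩ := B.exists_root
  have hprime : (Ideal.span {(X - C s : ℂ[X])}).IsPrime := by
    rw [Ideal.span_singleton_prime (X_sub_C_ne_zero s)]
    exact prime_X_sub_C s
  have hdeg : B.kummerInt.degree = n := degree_X_pow_sub_C (NeZero.pos n) _
  have hdvd : (X - C s) ∣ B.poly := Dvd.dvd.mul_left (Finset.dvd_prod_of_mem _ hs) _
  refine irreducible_of_eisenstein_criterion hprime ?_ ?_ ?_ ?_ B.monic_kummerInt.isPrimitive
  · rw [B.monic_kummerInt.leadingCoeff]
    exact fun h ↦ hprime.ne_top ((Ideal.eq_top_iff_one _).2 h)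
  · intro k hk
    rw [hdeg, Nat.cast_lt] at hk
    rw [Ideal.mem_span_singleton, kummerInt, coeff_sub, coeff_X_pow, if_neg hk.ne, coeff_C]
    split_ifs <;> simp [hdvd]
  · rw [hdeg]
    exact_mod_cast NeZero.pos n
  · rw [kummerInt, coeff_sub, coeff_X_pow, if_neg (NeZero.ne n).symm, coeff_C_zero, zero_sub,
      Ideal.neg_mem_iff, Ideal.span_singleton_pow, Ideal.mem_span_singleton]
    intro h
    have := B.separable_poly.squarefree (X - C s) (by rwa [← sq])
    exact not_isUnit_X_sub_C s this

instance fact_irreducible : Fact (Irreducible B.kummer) := ⟨by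
  rw [← map_kummerInt]
  exact (B.monic_kummerInt.irreducible_iff_irreducible_map_fraction_map).1
    B.irreducible_kummerInt⟩

/-- The function field `ℂ(t, z)`, `z ^ n = B(t)`. -/
abbrev FunField : Type := AdjoinRoot B.kummer

/-- The coordinate `t`. -/
noncomputable def t : B.FunField := algebraMap (RatFunc ℂ) B.FunField RatFunc.X

/-- The coordinate `z`. -/
noncomputable def z : B.FunField := AdjoinRoot.root B.kummer

theorem aeval_t (p : ℂ[X]) :
    aeval B.t p = algebraMap (RatFunc ℂ) B.FunField (algebraMap ℂ[X] (RatFunc ℂ) p) := by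
  have h : (aeval B.t : ℂ[X] →ₐ[ℂ] B.FunField) =
      (IsScalarTower.toAlgHom ℂ (RatFunc ℂ) B.FunField).comp
        (IsScalarTower.toAlgHom ℂ ℂ[X] (RatFunc ℂ)) := by
    ext
    simp [t]
  exact DFunLike.congr_fun h p

theorem z_pow : B.z ^ n = aeval B.t B.poly := by
  have key (r : B.FunField) (f : RatFunc ℂ →+* B.FunField) :
      B.kummer.eval₂ f r = r ^ n - f (algebraMap ℂ[X] (RatFunc ℂ) B.poly) := by
    simp [kummer, eval₂_sub]
  have h := AdjoinRoot.eval₂_root B.kummer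
  rw [key, sub_eq_zero] at h
  rw [aeval_t, AdjoinRoot.algebraMap_eq]
  exact h

theorem aeval_t_ne_zero {p : ℂ[X]} (hp : p ≠ 0) : aeval B.t p ≠ 0 := by
  rw [aeval_t]
  simpa using hp

theorem z_ne_zero : B.z ≠ 0 := by
  intro h
  have := B.z_pow
  rw [h, zero_pow (NeZero.ne n)] at this
  exact B.aeval_t_ne_zero B.poly_ne_zero this.symm

/-- The power basis of the function field over `ℂ(t)`. -/
noncomputable def basis : Module.Basis (Fin n) (RatFunc ℂ) B.FunField :=
  (AdjoinRoot.powerBasis' B.monic_kummer).basis.reindex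
    (finCongr (by simp [natDegree_kummer]))

theorem basis_apply (k : Fin n) : B.basis k = B.z ^ (k : ℕ) := by
  simp [basis, z]

theorem exists_repr (p : B.FunField) :
    ∃ g : Fin n → RatFunc ℂ, p = ∑ k, algebraMap (RatFunc ℂ) B.FunField (g k) * B.z ^ (k : ℕ) := by
  refine ⟨B.basis.repr p, ?_⟩
  conv_lhs => rw [← B.basis.sum_repr p]
  simp only [basis_apply, Algebra.smul_def]

theorem repr_unique {g h : Fin n → RatFunc ℂ}
    (e : ∑ k, algebraMap (RatFunc ℂ) B.FunField (g k) * B.z ^ (k : ℕ) =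
      ∑ k, algebraMap (RatFunc ℂ) B.FunField (h k) * B.z ^ (k : ℕ)) : g = h := by
  simp only [← basis_apply, ← Algebra.smul_def] at e
  rw [← B.basis.equivFun_symm_apply, ← B.basis.equivFun_symm_apply] at e
  exact B.basis.equivFun.symm.injective e

/-- A point of the curve with transcendental abscissa induces a homomorphism. -/
theorem exists_algHom {L : Type*} [Field L] [Algebra ℂ L] {T Z : L} (hT : Transcendental ℂ T)
    (hZ : Z ^ n = aeval T B.poly) : ∃ ε : B.FunField →ₐ[ℂ] L, ε B.t = T ∧ ε B.z = Z := by
  have hT' : nonZeroDivisors ℂ[X] ≤ (nonZeroDivisors L).comap (aeval (R := ℂ) T) := by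
    intro p hp
    rw [Submonoid.mem_comap, mem_nonZeroDivisors_iff_ne_zero]
    exact fun h ↦ nonZeroDivisors.ne_zero hp (transcendental_iff.1 hT p h)
  let i : RatFunc ℂ →ₐ[ℂ] L := RatFunc.liftAlgHom (aeval T) hT'
  have hi : ∀ p : ℂ[X], i (algebraMap ℂ[X] (RatFunc ℂ) p) = aeval T p := fun p ↦ by
    simp [i, RatFunc.liftAlgHom_apply]
  have h0 : B.kummer.eval₂ (i : RatFunc ℂ →+* L) Z = 0 := by
    simp [kummer, eval₂_sub, hi, hZ]
  refine ⟨AdjoinRoot.liftAlgHom B.kummer i Z h0, ?_, ?_⟩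
  · have : (RatFunc.X : RatFunc ℂ) = algebraMap ℂ[X] (RatFunc ℂ) X := by simp
    rw [t, AdjoinRoot.algebraMap_eq, AdjoinRoot.liftAlgHom_of, this, hi, aeval_X]
  · exact AdjoinRoot.liftAlgHom_root ..

theorem mem_of_t_mem_of_z_mem (F : IntermediateField ℂ B.FunField) (ht : B.t ∈ F) (hz : B.z ∈ F)
    (x : B.FunField) : x ∈ F := by
  have hp : ∀ p : ℂ[X], aeval B.t p ∈ F := fun p ↦ by
    rw [aeval_eq_sum_range]
    exact F.sum_mem fun i _ ↦ F.smul_mem (pow_mem ht i)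
  obtain ⟨g, rfl⟩ := B.exists_repr x
  refine F.sum_mem fun k _ ↦ F.mul_mem ?_ (pow_mem hz _)
  rw [← RatFunc.num_div_denom (g k), map_div₀, ← aeval_t, ← aeval_t]
  exact F.div_mem (hp _) (hp _)

theorem algHom_ext {L : Type*} [Field L] [Algebra ℂ L] {ε δ : B.FunField →ₐ[ℂ] L}
    (ht : ε B.t = δ B.t) (hz : ε B.z = δ B.z) : ε = δ := by
  refine AlgHom.ext fun x ↦ ?_
  exact B.mem_of_t_mem_of_z_mem
    (F := { AlgHom.equalizer ε δ with
      inv_mem' := fun a (ha : ε a = δ a) ↦ show ε a⁻¹ = δ a⁻¹ by rw [map_inv₀, map_inv₀, ha] })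
    ht hz x

end SplitForm

end Polynomial

namespace Polynomial

open FormalLaurent

theorem aeval_mem_integers {T : FormalLaurent} (hT : T ∈ integers) (p : ℂ[X]) :
    aeval T p ∈ integers := by
  rw [aeval_eq_sum_range]
  exact integers.sum_mem fun i _ ↦ integers.smul_mem (pow_mem hT i) _

theorem exists_aeval_add_eq (p : ℂ[X]) (s : ℂ) {U : FormalLaurent} (hU : U ∈ integers) :
    ∃ y ∈ integers, aeval (algebraMap ℂ FormalLaurent s + U) p =
      algebraMap ℂ FormalLaurent (p.eval s) + U * y := by
  obtain ⟨q, hq⟩ := X_sub_C_dvd_sub_C_eval (a := s) (p := p)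
  refine ⟨aeval (algebraMap ℂ FormalLaurent s + U) q,
    aeval_mem_integers (add_mem (algebraMap_mem s) hU) q, ?_⟩
  have := congr(aeval (algebraMap ℂ FormalLaurent s + U) $hq)
  simp only [map_sub, map_mul, aeval_C, aeval_X, add_sub_cancel_left] at this
  rw [← this]
  ring

theorem exists_aeval_inv_mul_pow_eq (p : ℂ[X]) {U : FormalLaurent} (hU : U ∈ integers)
    (hU0 : U ≠ 0) : ∃ y ∈ integers, aeval U⁻¹ p * U ^ p.natDegree =
      algebraMap ℂ FormalLaurent p.leadingCoeff + U * y := by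
  refine ⟨aeval U p.reverse.divX, aeval_mem_integers hU _, ?_⟩
  have key : aeval U⁻¹ p * U ^ p.natDegree = aeval U p.reverse := by
    let i : Invertible U⁻¹ := invertibleOfNonzero (inv_ne_zero hU0)
    have := eval₂_reverse_mul_pow (algebraMap ℂ FormalLaurent) U⁻¹ p
    rw [invOf_eq_inv, inv_inv] at this
    rw [aeval_def, ← this, mul_assoc, ← mul_pow, inv_mul_cancel₀ hU0, one_pow, mul_one, aeval_def]
  rw [key]
  conv_lhs => rw [← divX_mul_X_add p.reverse]
  simp only [map_add, map_mul, aeval_X, aeval_C, coeff_zero_reverse]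
  ring

theorem D_aeval (p : ℂ[X]) (T : FormalLaurent) :
    D (aeval T p) = aeval T (derivative p) * D T := by
  rw [Derivation.map_aeval, smul_eq_mul]

/-- Fourier inversion for the group of `n`-th roots of unity. -/
theorem _root_.IsPrimitiveRoot.sum_pow_smul_sum {n : ℕ} [NeZero n] {ζ : ℂ}
    (hζ : IsPrimitiveRoot ζ n)
    {M : Type*} [AddCommGroup M] [Module ℂ M] (c : Fin n → M) (k : Fin n) (e : ℕ) :
    ∑ i ∈ Finset.range n, (ζ⁻¹ ^ ((k : ℕ) + e)) ^ i • ∑ l : Fin n, (ζ ^ ((l : ℕ) + e)) ^ i • c l =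
      (n : ℂ) • c k := by
  have hζ0 : ζ ≠ 0 := hζ.ne_zero (NeZero.ne n)
  simp only [Finset.smul_sum, smul_smul]
  rw [Finset.sum_comm, Finset.sum_eq_single k]
  · rw [← Finset.sum_smul]
    congr 1
    rw [Finset.sum_congr rfl (g := fun _ ↦ (1 : ℂ))]
    · simp
    · intro i _
      rw [← mul_pow, ← mul_pow, inv_mul_cancel₀ hζ0, one_pow, one_pow]
  · intro l _ hl
    rw [← Finset.sum_smul]
    convert zero_smul ℂ (c l)
    set ω : ℂ := ζ⁻¹ ^ ((k : ℕ) + e) * ζ ^ ((l : ℕ) + e) with hω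
    have h1 : ω ≠ 1 := by
      intro h
      have : ζ ^ (l : ℕ) = ζ ^ (k : ℕ) := by
        rw [hω, inv_pow, inv_mul_eq_one₀ (pow_ne_zero _ hζ0), pow_add, pow_add] at h
        exact (mul_right_cancel₀ (pow_ne_zero _ hζ0) h).symm
      exact hl (Fin.ext (hζ.pow_inj l.2 k.2 this))
    have h2 : ω ^ n = 1 := by
      rw [hω, mul_pow, ← pow_mul, ← pow_mul, mul_comm _ n, mul_comm _ n, pow_mul, pow_mul,
        inv_pow, hζ.pow_eq_one]
      simp
    rw [Finset.sum_congr rfl (g := fun i ↦ ω ^ i) fun i _ ↦ by rw [hω, mul_pow]]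
    rw [geom_sum_eq h1, h2, sub_self, zero_div]
  · simp

namespace SplitForm

variable {n : ℕ} (B : SplitForm n) [NeZero n]

/-- The differential `p dt` is regular at every place of the function field. -/
def IsRegular (p : B.FunField) : Prop :=
  ∀ ε : B.FunField →ₐ[ℂ] FormalLaurent, ε p * D (ε B.t) ∈ integers

/-- `x` is a polynomial of degree at most `r` in `t` and `z`. -/
def HasDegLE (r : ℕ) (x : B.FunField) : Prop :=
  ∃ g : Fin n → ℂ[X], (∀ k : Fin n, g k ∈ degreeLT ℂ (r + 1 - k)) ∧
    x = ∑ k, aeval B.t (g k) * B.z ^ (k : ℕ)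

variable {B}

theorem map_z_pow {L : Type*} [Field L] [Algebra ℂ L] (ε : B.FunField →ₐ[ℂ] L) :
    (ε B.z) ^ n = aeval (ε B.t) B.poly := by
  rw [← map_pow, B.z_pow, aeval_algHom_apply]

theorem D_z (ε : B.FunField →ₐ[ℂ] FormalLaurent) :
    n * (ε B.z) ^ (n - 1) * D (ε B.z) = aeval (ε B.t) (derivative B.poly) * D (ε B.t) := by
  rw [← D_aeval, ← map_z_pow, Derivation.leibniz_pow, nsmul_eq_mul, smul_eq_mul, mul_assoc]

theorem map_z_ne_zero {L : Type*} [Field L] [Algebra ℂ L] (ε : B.FunField →ₐ[ℂ] L) :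
    ε B.z ≠ 0 := (_root_.map_ne_zero ε).2 B.z_ne_zero

theorem isRegular_monomial {i j : ℕ} (hij : i + j + 3 ≤ n) :
    B.IsRegular (B.t ^ i * B.z ^ j / B.z ^ (n - 1)) := by
  intro ε
  rw [map_div₀, map_mul, map_pow, map_pow, map_pow]
  have hZ0 := map_z_ne_zero ε
  have hZn := map_z_pow ε
  have hD := D_z ε
  generalize ε B.t = T at *
  generalize ε B.z = Z at *
  by_cases hT : T ∈ integers
  · have hZ : Z ∈ integers := by
      refine mem_of_pow_mem (NeZero.ne n) ?_
      rw [hZn]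
      exact aeval_mem_integers hT _
    obtain ⟨a, b, hab⟩ := B.separable_poly
    have hab' := congr(aeval T $hab)
    rw [map_add, map_mul, map_mul, map_one, ← hZn] at hab'
    have hmain : T ^ i * Z ^ j / Z ^ (n - 1) * D T =
        T ^ i * Z ^ j * (aeval T a * Z * D T + aeval T b * (n * D Z)) := by
      have h1 : D T = Z ^ (n - 1) * (aeval T a * Z * D T + aeval T b * (n * D Z)) := by
        have h2 : Z ^ n = Z ^ (n - 1) * Z := by rw [← pow_succ, Nat.sub_add_cancel NeZero.one_le]
        calc D T = (aeval T a * Z ^ n + aeval T b * aeval T (derivative B.poly)) * D T := by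
              rw [hab', one_mul]
          _ = aeval T a * Z ^ n * D T + aeval T b * (n * Z ^ (n - 1) * D Z) := by rw [hD]; ring
          _ = _ := by rw [h2]; ring
      conv_lhs => rw [h1]
      field_simp
    rw [hmain]
    have hn : (n : FormalLaurent) ∈ integers := natCast_mem _ n
    exact mul_mem (mul_mem (pow_mem hT _) (pow_mem hZ _))
      (add_mem (mul_mem (mul_mem (aeval_mem_integers hT _) hZ) (D_mem hT))
        (mul_mem (aeval_mem_integers hT _) (mul_mem hn (D_mem hZ))))
  · obtain ⟨y, hy, hU⟩ := inv_eq_π_mul hT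
    have hT0 : T ≠ 0 := fun h ↦ hT (h ▸ zero_mem _)
    obtain ⟨U, rfl⟩ : ∃ U, T = U⁻¹ := ⟨T⁻¹, (inv_inv _).symm⟩
    rw [inv_inv] at hU
    have hU0 : U ≠ 0 := fun h ↦ hT0 (by rw [h, inv_zero])
    have hUO : U ∈ integers := hU ▸ mul_mem π_mem hy
    obtain ⟨w, hw, hrev⟩ := exists_aeval_inv_mul_pow_eq B.poly hUO hU0
    rw [B.natDegree_poly, ← hZn, ← mul_pow] at hrev
    set Q := Z * U with hQ
    have hlc : B.poly.leadingCoeff ≠ 0 := leadingCoeff_ne_zero.2 B.poly_ne_zero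
    have hQO : Q ∈ integers := by
      refine mem_of_pow_mem (NeZero.ne n) ?_
      rw [hrev]
      exact add_mem (algebraMap_mem _) (mul_mem hUO hw)
    have hQO' : Q⁻¹ ∈ integers := by
      refine mem_of_pow_mem (NeZero.ne n) ?_
      rw [inv_pow, hrev, hU, mul_assoc]
      exact inv_mem hlc (mul_mem hy hw)
    have hQ0 : Q ≠ 0 := mul_ne_zero hZ0 hU0
    have hZQ : Z = Q / U := by rw [hQ]; field_simp
    obtain ⟨e, rfl⟩ : ∃ e, n = i + j + 3 + e := ⟨n - (i + j + 3), by omega⟩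
    have hmain : U⁻¹ ^ i * Z ^ j / Z ^ (i + j + 3 + e - 1) * D U⁻¹ =
        -(D U * U ^ e * Q ^ j * Q⁻¹ ^ (i + j + 3 + e - 1)) := by
      rw [Derivation.leibniz_inv, hZQ, show i + j + 3 + e - 1 = i + j + 2 + e by omega, smul_eq_mul]
      simp only [div_pow, inv_pow]
      field_simp
      ring
    rw [hmain]
    exact neg_mem (mul_mem (mul_mem (mul_mem (D_mem hUO) (pow_mem hUO _)) (pow_mem hQO _))
      (pow_mem hQO' _))

theorem exists_pow_eq_add_pow (c : ℂ) : ∃ R : FormalLaurent,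
    R ^ n = algebraMap ℂ FormalLaurent c + π ^ n := by
  by_cases hc : c = 0
  · exact ⟨π, by simp [hc]⟩
  · obtain ⟨R, -, hR⟩ := exists_root_one_add n (NeZero.ne n) c⁻¹
    obtain ⟨d, hd⟩ := IsAlgClosed.exists_pow_nat_eq c (NeZero.pos n)
    refine ⟨algebraMap ℂ FormalLaurent d * R, ?_⟩
    rw [mul_pow, hR, ← map_pow, hd, mul_add, mul_one, ← mul_assoc, ← map_mul, mul_inv_cancel₀ hc,
      map_one, one_mul]

theorem exists_pow_eq_poly (T : FormalLaurent)
    (h : ∀ s : ℂ, ∃ R : FormalLaurent, R ^ n = T - algebraMap ℂ FormalLaurent s) :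
    ∃ Z : FormalLaurent, Z ^ n = aeval T B.poly := by
  choose R hR using h
  obtain ⟨d, hd⟩ := IsAlgClosed.exists_pow_nat_eq B.lead (NeZero.pos n)
  refine ⟨algebraMap ℂ FormalLaurent d * ∏ s ∈ B.roots, R s, ?_⟩
  rw [mul_pow, ← Finset.prod_pow, ← map_pow, hd, poly, map_mul, map_prod]
  simp [hR]

theorem exists_affine_point (s : ℂ) : ∃ Z : FormalLaurent,
    Z ^ n = aeval (algebraMap ℂ FormalLaurent s + π ^ n) B.poly := by
  refine exists_pow_eq_poly _ fun σ ↦ ?_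
  obtain ⟨R, hR⟩ := exists_pow_eq_add_pow (n := n) (s - σ)
  exact ⟨R, by rw [hR, map_sub]; ring⟩

theorem exists_infinite_point : ∃ Z : FormalLaurent, Z ^ n = aeval (π ^ n)⁻¹ B.poly := by
  refine exists_pow_eq_poly _ fun σ ↦ ?_
  obtain ⟨R, -, hR⟩ := exists_root_one_add n (NeZero.ne n) (-σ)
  refine ⟨R * π⁻¹, ?_⟩
  rw [mul_pow, hR, map_neg, inv_pow]
  have := π_ne_zero
  field_simp
  ring

omit [NeZero n] in
theorem D_affine (s : ℂ) :
    D (algebraMap ℂ FormalLaurent s + π ^ n) = n * π ^ (n - 1) := by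
  rw [map_add, Derivation.map_algebraMap, zero_add, Derivation.leibniz_pow, D_π]
  simp

theorem natCast_ne_zero' : (n : FormalLaurent) ≠ 0 := by
  have : CharZero FormalLaurent := algebraRat.charZero _
  exact NeZero.natCast_ne n _

theorem D_affine_ne_zero (s : ℂ) : D (algebraMap ℂ FormalLaurent s + π ^ n) ≠ 0 := by
  rw [D_affine]
  exact mul_ne_zero natCast_ne_zero' (pow_ne_zero _ π_ne_zero)

theorem D_infinite : D (π ^ n)⁻¹ = - (n * (π ^ (n + 1))⁻¹) := by
  have := π_ne_zero
  rw [Derivation.leibniz_inv, Derivation.leibniz_pow, D_π]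
  obtain ⟨m, hm⟩ : ∃ m, n = m + 1 := ⟨n - 1, by have := NeZero.pos n; omega⟩
  subst hm
  simp only [add_tsub_cancel_right, smul_eq_mul, nsmul_eq_mul]
  field_simp
  ring

theorem D_infinite_ne_zero : D (π ^ n)⁻¹ ≠ 0 := by
  rw [D_infinite]
  exact neg_ne_zero.2 (mul_ne_zero natCast_ne_zero' (inv_ne_zero (pow_ne_zero _ π_ne_zero)))

end SplitForm

end Polynomial

namespace Polynomial

namespace SplitForm

open FormalLaurent

variable {n : ℕ} {B : SplitForm n} [NeZero n]

theorem map_ratFunc {L : Type*} [Field L] [Algebra ℂ L] (ε : B.FunField →ₐ[ℂ] L) (f : RatFunc ℂ) :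
    ε (algebraMap (RatFunc ℂ) B.FunField f) = aeval (ε B.t) f.num / aeval (ε B.t) f.denom := by
  conv_lhs => rw [← RatFunc.num_div_denom f, map_div₀, ← aeval_t, ← aeval_t, map_div₀,
    ← aeval_algHom_apply, ← aeval_algHom_apply]

theorem IsRegular.component_mem {h : Fin n → RatFunc ℂ}
    (hp : B.IsRegular
      (∑ k, algebraMap (RatFunc ℂ) B.FunField (h k) * B.z ^ ((k : ℕ) + 1) / B.z ^ n))
    {T Z : FormalLaurent} (hT : D T ≠ 0) (hZ : Z ^ n = aeval T B.poly) (k : Fin n) :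
    aeval T (h k).num / aeval T (h k).denom * Z ^ ((k : ℕ) + 1) / Z ^ n * D T ∈ integers := by
  have hn := NeZero.ne n
  obtain ⟨ζ, hζ⟩ : ∃ ζ : ℂ, IsPrimitiveRoot ζ n := ⟨_, Complex.isPrimitiveRoot_exp n hn⟩
  have hn0 : (n : ℂ) ≠ 0 := Nat.cast_ne_zero.2 hn
  set c : Fin n → FormalLaurent := fun k ↦
    aeval T (h k).num / aeval T (h k).denom * Z ^ ((k : ℕ) + 1) / Z ^ n * D T with hc
  have key : ∀ i : ℕ, ∑ l : Fin n, (ζ ^ ((l : ℕ) + 1)) ^ i • c l ∈ integers := by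
    intro i
    have hζi : (ζ ^ i) ^ n = 1 := by rw [← pow_mul, mul_comm, pow_mul, hζ.pow_eq_one, one_pow]
    have hZ' : (ζ ^ i • Z) ^ n = Z ^ n := by rw [_root_.smul_pow, hζi, one_smul]
    obtain ⟨ε, hεt, hεz⟩ := exists_algHom (Z := ζ ^ i • Z) B (transcendental_of_D_ne_zero hT)
      (hZ'.trans hZ)
    have h1 := hp ε
    rw [map_sum, hεt, Finset.sum_mul] at h1
    convert h1 using 2 with l
    rw [map_div₀, map_mul, map_ratFunc, map_pow, map_pow, hεz, hεt, hZ', _root_.smul_pow, hc]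
    simp only [Algebra.smul_def]
    rw [← pow_mul, mul_comm ((l : ℕ) + 1) i, ← pow_mul]
    ring
  have h2 := hζ.sum_pow_smul_sum c k 1
  have h3 : (n : ℂ) • c k ∈ integers := by
    rw [← h2]
    exact integers.sum_mem fun i _ ↦ integers.smul_mem (key i) _
  have h4 := integers.smul_mem h3 (n : ℂ)⁻¹
  rwa [smul_smul, inv_mul_cancel₀ hn0, one_smul] at h4

theorem pow_mem_integers (m : ℕ) : π ^ m ∈ integers := pow_mem π_mem m

theorem IsRegular.denom_eq_one {h : Fin n → RatFunc ℂ}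
    (hp : B.IsRegular
      (∑ k, algebraMap (RatFunc ℂ) B.FunField (h k) * B.z ^ ((k : ℕ) + 1) / B.z ^ n))
    (k : Fin n) : (h k).denom = 1 := by
  by_contra hne
  have hdeg : (h k).denom.degree ≠ 0 := fun h0 ↦ hne <|
    (RatFunc.monic_denom (h k)).natDegree_eq_zero.1 (natDegree_eq_of_degree_eq_some h0)
  obtain ⟨s, hs⟩ := IsAlgClosed.exists_root _ hdeg
  obtain ⟨Z, hZ⟩ := exists_affine_point (B := B) s
  have hD := D_affine_ne_zero (n := n) s
  have hmem := hp.component_mem hD hZ k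
  have hπn := pow_mem_integers n
  have hTO : algebraMap ℂ FormalLaurent s + π ^ n ∈ integers := add_mem (algebraMap_mem s) hπn
  have hZO : Z ∈ integers := mem_of_pow_mem (NeZero.ne n) (hZ ▸ aeval_mem_integers hTO _)
  obtain ⟨ε, -, hεz⟩ := exists_algHom B (transcendental_of_D_ne_zero hD) hZ
  have hZ0 : Z ≠ 0 := hεz ▸ map_z_ne_zero ε
  obtain ⟨y, hy, hnum⟩ := exists_aeval_add_eq (h k).num s hπn
  obtain ⟨w, hw, hden⟩ := exists_aeval_add_eq (h k).denom s hπn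
  have hd0 : aeval (algebraMap ℂ FormalLaurent s + π ^ n) (h k).denom ≠ 0 :=
    fun h0 ↦ RatFunc.denom_ne_zero (h k)
      (transcendental_iff.1 (transcendental_of_D_ne_zero hD) _ h0)
  rw [hs.eq_zero, map_zero, zero_add] at hden
  rw [hden] at hd0
  have hw0 : w ≠ 0 := right_ne_zero_of_mul hd0
  have hπ := π_ne_zero
  have hn0 := natCast_ne_zero' (n := n)
  rw [hden, hnum, D_affine] at hmem
  obtain ⟨a, ha⟩ : ∃ a, n = k + 1 + a := ⟨n - (k + 1), by omega⟩
  obtain ⟨E, hE⟩ : ∃ E, E = (algebraMap ℂ FormalLaurent ((h k).num.eval s) + π ^ n * y) /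
    (π ^ n * w) * Z ^ ((k : ℕ) + 1) / Z ^ n * (n * π ^ (n - 1)) := ⟨_, rfl⟩
  rw [← hE] at hmem
  have hnval : (n : FormalLaurent)⁻¹ ∈ integers := by
    have := algebraMap_mem ((n : ℂ)⁻¹)
    rwa [map_inv₀, map_natCast] at this
  have hfin : algebraMap ℂ FormalLaurent ((h k).num.eval s) =
      π * (E * w * Z ^ a * (n : FormalLaurent)⁻¹ - π ^ (n - 1) * y) := by
    have h1 : π ^ n = π * π ^ (n - 1) := by
      rw [← pow_succ', Nat.sub_add_cancel NeZero.one_le]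
    have h2 : Z ^ n = Z ^ ((k : ℕ) + 1) * Z ^ a := by rw [← pow_add, ← ha]
    rw [hE, h1, h2]
    field_simp
    ring
  have hzero := eq_zero_of_eq_π_mul (sub_mem (mul_mem (mul_mem
    (mul_mem hmem hw) (pow_mem hZO _)) hnval) (mul_mem (pow_mem_integers _) hy)) hfin
  obtain ⟨a, b, hab⟩ := RatFunc.isCoprime_num_denom (h k)
  have := congr(eval s $hab)
  simp [hzero, hs.eq_zero] at this

theorem IsRegular.num_mem_degreeLT (hn : 3 ≤ n) {h : Fin n → RatFunc ℂ}
    (hp : B.IsRegular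
      (∑ k, algebraMap (RatFunc ℂ) B.FunField (h k) * B.z ^ ((k : ℕ) + 1) / B.z ^ n))
    (k : Fin n) : (h k).num ∈ degreeLT ℂ (n - 3 + 1 - k) := by
  rw [mem_degreeLT]
  by_contra hlt
  have hg0 : (h k).num ≠ 0 := by
    rintro h0
    rw [h0, degree_zero] at hlt
    exact hlt (WithBot.bot_lt_coe _)
  rw [degree_eq_natDegree hg0, Nat.cast_lt, not_lt] at hlt
  obtain ⟨Z, hZ⟩ := exists_infinite_point (B := B)
  have hD := D_infinite_ne_zero (n := n)
  have hmem := hp.component_mem hD hZ k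
  have hπn := pow_mem_integers n
  have hπ := π_ne_zero
  have hπn0 : π ^ n ≠ 0 := pow_ne_zero _ hπ
  have hn0 := natCast_ne_zero' (n := n)
  obtain ⟨ε, -, hεz⟩ := exists_algHom B (transcendental_of_D_ne_zero hD) hZ
  have hZ0 : Z ≠ 0 := hεz ▸ map_z_ne_zero ε
  rw [hp.denom_eq_one k, map_one, div_one, D_infinite] at hmem
  obtain ⟨w, hw, hQn⟩ := exists_aeval_inv_mul_pow_eq B.poly hπn hπn0
  obtain ⟨y, hy, hnum⟩ := exists_aeval_inv_mul_pow_eq (h k).num hπn hπn0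
  rw [B.natDegree_poly, ← hZ, ← mul_pow] at hQn
  obtain ⟨Q, hQ⟩ : ∃ Q, Q = Z * π ^ n := ⟨_, rfl⟩
  rw [← hQ] at hQn
  have hQO : Q ∈ integers := mem_of_pow_mem (NeZero.ne n)
    (hQn ▸ add_mem (algebraMap_mem _) (mul_mem hπn hw))
  have hQ0 : Q ≠ 0 := hQ ▸ mul_ne_zero hZ0 hπn0
  have hZQ : Z = Q / π ^ n := by rw [hQ]; field_simp
  set d := (h k).num.natDegree
  rw [← eq_div_iff (pow_ne_zero _ hπn0)] at hnum
  obtain ⟨E, hE⟩ : ∃ E, E = aeval (π ^ n)⁻¹ (h k).num * Z ^ ((k : ℕ) + 1) / Z ^ n *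
    -(n * (π ^ (n + 1))⁻¹) := ⟨_, rfl⟩
  rw [← hE] at hmem
  obtain ⟨a, ha⟩ : ∃ a, n = k + 1 + a := ⟨n - (k + 1), by omega⟩
  obtain ⟨e, he⟩ : ∃ e, d + k + 2 = n + e := ⟨d + k + 2 - n, by omega⟩
  have hnval : (n : FormalLaurent)⁻¹ ∈ integers := by
    have := algebraMap_mem ((n : ℂ)⁻¹)
    rwa [map_inv₀, map_natCast] at this
  have hfin : algebraMap ℂ FormalLaurent (h k).num.leadingCoeff =
      π * (-(E * Q ^ a * (n : FormalLaurent)⁻¹ * π ^ (n * e)) - π ^ (n - 1) * y) := by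
    have h1 : π ^ n = π * π ^ (n - 1) := by
      rw [← pow_succ', Nat.sub_add_cancel NeZero.one_le]
    have h2 : Q ^ n = Q ^ ((k : ℕ) + 1) * Q ^ a := by rw [← pow_add, ← ha]
    have h3 : (π ^ n) ^ n * (π ^ n) ^ e = (π ^ n) ^ d * (π ^ n) ^ ((k : ℕ) + 1) * π ^ n := by
      rw [← pow_add, ← pow_add, ← pow_succ, ← he]
      ring
    rw [hE, hnum, hZQ, div_pow, div_pow, h2, pow_succ π n, pow_mul]
    generalize hP : π ^ n = P at *
    have h4 : P ^ e = P ^ d * P ^ ((k : ℕ) + 1) * P / P ^ n := by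
      rw [eq_div_iff (pow_ne_zero _ hπn0), ← h3]; ring
    rw [h4]
    field_simp
    rw [h1]
    ring
  have hzero := eq_zero_of_eq_π_mul (sub_mem (neg_mem (mul_mem (mul_mem
    (mul_mem hmem (pow_mem hQO _)) hnval) (pow_mem_integers _)))
    (mul_mem (pow_mem_integers _) hy)) hfin
  exact hg0 (leadingCoeff_eq_zero.1 hzero)

theorem IsRegular.hasDegLE (hn : 3 ≤ n) {p : B.FunField} (hp : B.IsRegular p) :
    B.HasDegLE (n - 3) (p * B.z ^ (n - 1)) := by
  obtain ⟨h, hh⟩ := B.exists_repr (p * B.z ^ (n - 1))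
  have hp' : p = ∑ k, algebraMap (RatFunc ℂ) B.FunField (h k) * B.z ^ ((k : ℕ) + 1) / B.z ^ n := by
    have h1 : B.z ^ n = B.z ^ (n - 1) * B.z := by
      rw [← pow_succ, Nat.sub_add_cancel NeZero.one_le]
    have := B.z_ne_zero
    rw [← Finset.sum_div, eq_div_iff (pow_ne_zero _ this), h1, ← mul_assoc, hh, Finset.sum_mul]
    exact Finset.sum_congr rfl fun k _ ↦ by ring
  rw [hp'] at hp
  refine ⟨fun k ↦ (h k).num, hp.num_mem_degreeLT hn, ?_⟩
  rw [hh]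
  refine Finset.sum_congr rfl fun k _ ↦ ?_
  rw [aeval_t, ← RatFunc.num_div_denom (h k), hp.denom_eq_one k]
  simp

theorem exists_D_ne_zero : ∃ ε : B.FunField →ₐ[ℂ] FormalLaurent, D (ε B.t) ≠ 0 := by
  obtain ⟨Z, hZ⟩ := exists_affine_point (B := B) 0
  have hD := D_affine_ne_zero (n := n) 0
  obtain ⟨ε, hεt, -⟩ := exists_algHom B (transcendental_of_D_ne_zero hD) hZ
  exact ⟨ε, hεt ▸ hD⟩

variable (B) in
/-- Every differential is a multiple of `dt`. -/
theorem exists_D_eq (q : B.FunField) :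
    ∃ ρ, ∀ ε : B.FunField →ₐ[ℂ] FormalLaurent, D (ε q) = ε ρ * D (ε B.t) := by
  refine B.mem_of_t_mem_of_z_mem (F :=
    { carrier := {q | ∃ ρ, ∀ ε : B.FunField →ₐ[ℂ] FormalLaurent, D (ε q) = ε ρ * D (ε B.t)}
      add_mem' := ?_
      mul_mem' := ?_
      algebraMap_mem' := ?_
      inv_mem' := ?_ }) ?_ ?_ q
  · rintro a b ⟨ρ, h⟩ ⟨σ, h'⟩
    exact ⟨a * σ + b * ρ, fun ε ↦ by
      rw [map_mul, Derivation.leibniz, h, h', map_add, map_mul, map_mul, smul_eq_mul, smul_eq_mul]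
      ring⟩
  · rintro a b ⟨ρ, h⟩ ⟨σ, h'⟩
    exact ⟨ρ + σ, fun ε ↦ by rw [map_add, map_add, h, h', map_add, add_mul]⟩
  · intro c
    exact ⟨0, fun ε ↦ by rw [AlgHom.commutes, Derivation.map_algebraMap, map_zero, zero_mul]⟩
  · rintro a ⟨ρ, h⟩
    refine ⟨-(a⁻¹ ^ 2 * ρ), fun ε ↦ ?_⟩
    rw [map_inv₀, Derivation.leibniz_inv, h, map_neg, map_mul, map_pow, map_inv₀, smul_eq_mul]
    ring
  · exact ⟨1, fun ε ↦ by rw [map_one, one_mul]⟩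
  · refine ⟨aeval B.t (derivative B.poly) / (n * B.z ^ (n - 1)), fun ε ↦ ?_⟩
    have h0 := map_z_ne_zero ε
    have hn0 := natCast_ne_zero' (n := n)
    rw [map_div₀, ← aeval_algHom_apply, map_mul, map_natCast, map_pow, div_mul_eq_mul_div, ← D_z]
    field_simp

theorem exists_multiplier (hn : 3 ≤ n) {B' : SplitForm n} (θ : B'.FunField ≃ₐ[ℂ] B.FunField) :
    ∃ u : B.FunField, u ≠ 0 ∧ ∀ i j : ℕ, i + j + 3 ≤ n →
      B.HasDegLE (n - 3) (u * (θ B'.t ^ i * θ B'.z ^ j)) := by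
  obtain ⟨ρ, hρ⟩ := B.exists_D_eq (θ B'.t)
  have hρ0 : ρ ≠ 0 := by
    rintro rfl
    obtain ⟨ε, hε⟩ := exists_D_ne_zero (B := B')
    have := hρ (ε.comp θ.symm.toAlgHom)
    simp at this
    exact hε this
  have hz' : θ B'.z ≠ 0 := by
    rw [Ne, map_eq_zero_iff θ θ.injective]
    exact B'.z_ne_zero
  refine ⟨ρ * B.z ^ (n - 1) / θ B'.z ^ (n - 1), div_ne_zero (mul_ne_zero hρ0
    (pow_ne_zero _ B.z_ne_zero)) (pow_ne_zero _ hz'), fun i j hij ↦ ?_⟩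
  have hreg : B.IsRegular (ρ * (θ B'.t ^ i * θ B'.z ^ j / θ B'.z ^ (n - 1))) := by
    intro ε
    have h1 := isRegular_monomial (B := B') hij (ε.comp θ.toAlgHom)
    simp only [AlgHom.comp_apply, map_div₀, map_mul, map_pow] at h1 ⊢
    have h2 := hρ ε
    convert h1 using 1
    change _ = ε (θ B'.t) ^ i * ε (θ B'.z) ^ j / ε (θ B'.z) ^ (n - 1) * D (ε (θ B'.t))
    rw [h2]
    ring
  have := hreg.hasDegLE hn
  convert this using 1
  ring

end SplitForm

end Polynomial

section CayleyBacharach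

variable {K : Type*} [Field K]

/-- The affine-linear form `l.1 x + l.2.1 y + l.2.2`. -/
def lineForm (l : K × K × K) (p : K × K) : K := l.1 * p.1 + l.2.1 * p.2 + l.2.2

/-- The linear form is not constant. -/
def IsLine (l : K × K × K) : Prop := l.1 ≠ 0 ∨ l.2.1 ≠ 0

/-- The functional `∑ c p • ev_p` kills all polynomials of degree at most `r`. -/
def KillsDegLE (c : K × K → K) (s : Finset (K × K)) (r : ℕ) : Prop :=
  ∀ i j : ℕ, i + j ≤ r → ∑ p ∈ s, c p * (p.1 ^ i * p.2 ^ j) = 0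

open Classical in
theorem KillsDegLE.mul_lineForm {c : K × K → K} {s : Finset (K × K)} {r : ℕ}
    (h : KillsDegLE c s (r + 1)) (l : K × K × K) :
    KillsDegLE (fun p ↦ c p * lineForm l p) (s.filter fun p ↦ lineForm l p ≠ 0) r := by
  intro i j hij
  rw [Finset.sum_filter_of_ne fun p _ hp ↦ right_ne_zero_of_mul (left_ne_zero_of_mul hp)]
  have h1 := h (i + 1) j (by omega)
  have h2 := h i (j + 1) (by omega)
  have h3 := h i j (by omega)
  have : ∑ p ∈ s, c p * lineForm l p * (p.1 ^ i * p.2 ^ j) =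
      l.1 * ∑ p ∈ s, c p * (p.1 ^ (i + 1) * p.2 ^ j) +
      l.2.1 * ∑ p ∈ s, c p * (p.1 ^ i * p.2 ^ (j + 1)) +
      l.2.2 * ∑ p ∈ s, c p * (p.1 ^ i * p.2 ^ j) := by
    simp only [Finset.mul_sum, ← Finset.sum_add_distrib]
    refine Finset.sum_congr rfl fun p _ ↦ ?_
    rw [lineForm]
    ring
  rw [this, h1, h2, h3]
  ring

/-- Two distinct points are joined by a line. -/
theorem exists_isLine_through {p q : K × K} (h : p ≠ q) :
    ∃ l : K × K × K, IsLine l ∧ lineForm l p = 0 ∧ lineForm l q = 0 := by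
  refine ⟨(p.2 - q.2, q.1 - p.1, p.1 * q.2 - p.2 * q.1), ?_, ?_, ?_⟩
  · by_contra hne
    simp only [IsLine, not_or, not_not, sub_eq_zero] at hne
    exact h (Prod.ext hne.2.symm hne.1)
  · simp only [lineForm]; ring
  · simp only [lineForm]; ring

/-- There is a line through `q` avoiding `p ≠ q`. -/
theorem exists_line_separating {p q : K × K} (h : p ≠ q) :
    ∃ l : K × K × K, lineForm l p ≠ 0 ∧ lineForm l q = 0 := by
  by_cases h1 : p.1 = q.1
  · have h2 : p.2 ≠ q.2 := fun h2 ↦ h (Prod.ext h1 h2)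
    exact ⟨(0, 1, -q.2), by simpa [lineForm, ← sub_eq_add_neg, sub_eq_zero] using h2,
      by simp [lineForm]⟩
  · exact ⟨(1, 0, -q.1), by simpa [lineForm, ← sub_eq_add_neg, sub_eq_zero] using h1,
      by simp [lineForm]⟩

theorem KillsDegLE.exists_ne {r : ℕ} {c : K × K → K} {s : Finset (K × K)}
    (hc : ∀ p ∈ s, c p ≠ 0) (h : KillsDegLE c s r) {p : K × K} (hp : p ∈ s) :
    ∃ q ∈ s, q ≠ p := by
  by_contra! hne
  have : s = {p} := Finset.eq_singleton_iff_unique_mem.2 ⟨hp, hne⟩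
  have h0 := h 0 0 (by omega)
  rw [this] at h0
  simp at h0
  exact hc p hp h0

theorem KillsDegLE.add_two_le_card {r : ℕ} {c : K × K → K} {s : Finset (K × K)}
    (hc : ∀ p ∈ s, c p ≠ 0) (hs : s.Nonempty) (h : KillsDegLE c s r) : r + 2 ≤ s.card := by
  classical
  obtain ⟨p, hp⟩ := hs
  obtain ⟨q, hq, hqp⟩ := h.exists_ne hc hp
  induction r generalizing c s p q with
  | zero => exact Finset.one_lt_card.2 ⟨q, hq, p, hp, hqp⟩
  | succ r ih =>
    obtain ⟨l, hlp, hlq⟩ := exists_line_separating hqp.symm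
    set s' := s.filter fun p ↦ lineForm l p ≠ 0
    have h' := h.mul_lineForm l
    have hp' : p ∈ s' := Finset.mem_filter.2 ⟨hp, hlp⟩
    have hc' : ∀ x ∈ s', c x * lineForm l x ≠ 0 := fun x hx ↦
      mul_ne_zero (hc x (Finset.mem_filter.1 hx).1) (Finset.mem_filter.1 hx).2
    obtain ⟨q', hq', hqp'⟩ := h'.exists_ne hc' hp'
    have h1 := ih hc' h' p hp' q' hq' hqp'
    have h2 : s'.card < s.card := Finset.card_lt_card
      (Finset.filter_ssubset.2 ⟨q, hq, by simpa using hlq⟩)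
    omega

/-- A set of at most `2 r + 1` points failing maximally to impose independent conditions on
polynomials of degree at most `r` is collinear. -/
theorem KillsDegLE.exists_line {r : ℕ} {c : K × K → K} {s : Finset (K × K)}
    (hc : ∀ p ∈ s, c p ≠ 0) (h : KillsDegLE c s r) (hcard : s.card ≤ 2 * r + 1) :
    ∃ l : K × K × K, IsLine l ∧ ∀ p ∈ s, lineForm l p = 0 := by
  classical
  rcases s.eq_empty_or_nonempty with rfl | hs
  · exact ⟨(1, 0, 0), by simp [IsLine], by simp⟩
  induction r generalizing c s with
  | zero =>
    have := h.add_two_le_card hc hs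
    omega
  | succ r ih =>
    have hcard2 := h.add_two_le_card hc hs
    let count : K × K × K → ℕ := fun l ↦ (s.filter fun p ↦ lineForm l p = 0).card
    obtain ⟨l, hl, hmax⟩ : ∃ l, IsLine l ∧ ∀ l', IsLine l' → count l' ≤ count l := by
      have hbdd : BddAbove (count '' {l | IsLine l}) := by
        refine ⟨s.card, ?_⟩
        rintro _ ⟨l, -, rfl⟩
        exact Finset.card_filter_le _ _
      have hne : (count '' {l | IsLine l}).Nonempty :=
        ⟨_, (1, 0, 0), by simp [IsLine], rfl⟩
      obtain ⟨l, hl, hle⟩ := Nat.sSup_mem hne hbdd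
      exact ⟨l, hl, fun l' hl' ↦ hle ▸ le_csSup hbdd ⟨l', hl', rfl⟩⟩
    have htwo : 2 ≤ count l := by
      obtain ⟨p, hp, q, hq, hpq⟩ := Finset.one_lt_card.1 (show 1 < s.card by omega)
      obtain ⟨l', hl', h1, h2⟩ := exists_isLine_through hpq
      refine le_trans ?_ (hmax l' hl')
      exact Finset.one_lt_card.2 ⟨p, Finset.mem_filter.2 ⟨hp, h1⟩, q,
        Finset.mem_filter.2 ⟨hq, h2⟩, hpq⟩
    set s' := s.filter fun p ↦ lineForm l p ≠ 0
    have hsum : count l + s'.card = s.card := Finset.card_filter_add_card_filter_not _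
    have hc' : ∀ x ∈ s', c x * lineForm l x ≠ 0 := fun x hx ↦
      mul_ne_zero (hc x (Finset.mem_filter.1 hx).1) (Finset.mem_filter.1 hx).2
    have h' := h.mul_lineForm l
    rcases s'.eq_empty_or_nonempty with hs' | hs'
    · refine ⟨l, hl, fun p hp ↦ ?_⟩
      by_contra hne
      have : p ∈ s' := Finset.mem_filter.2 ⟨hp, hne⟩
      simp [hs'] at this
    · obtain ⟨l', hl', hon⟩ := ih hc' h' (by omega) hs'
      have h1 : r + 2 ≤ s'.card := h'.add_two_le_card hc' hs'
      have h2 : s'.card ≤ count l' := Finset.card_le_card fun p hp ↦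
        Finset.mem_filter.2 ⟨(Finset.mem_filter.1 hp).1, hon p hp⟩
      have h3 := hmax l' hl'
      omega

end CayleyBacharach

namespace Polynomial

namespace SplitForm

variable {n : ℕ} {B : SplitForm n} [NeZero n]

theorem transcendental_t : Transcendental ℂ B.t :=
  transcendental_iff.2 fun p hp ↦ by
    by_contra h
    exact B.aeval_t_ne_zero h hp

theorem algebraMap_ratFunc (f : RatFunc ℂ) :
    algebraMap (RatFunc ℂ) B.FunField f = aeval B.t f.num / aeval B.t f.denom :=
  map_ratFunc (AlgHom.id ℂ B.FunField) f

variable (B) in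
/-- The deck transformations of the cyclic cover `z ^ n = B(t)` of the line. -/
theorem exists_deck {ζ : ℂ} (hζ : ζ ^ n = 1) : ∃ σ : ℕ → B.FunField →ₐ[ℂ] B.FunField,
    ∀ i, σ i B.t = B.t ∧ σ i B.z = ζ ^ i • B.z := by
  refine ⟨fun i ↦ (exists_algHom (Z := ζ ^ i • B.z) B transcendental_t ?_).choose, fun i ↦
    (exists_algHom (Z := ζ ^ i • B.z) B transcendental_t ?_).choose_spec⟩ <;>
  rw [_root_.smul_pow, ← pow_mul, mul_comm, pow_mul, hζ, one_pow, one_smul, B.z_pow]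

theorem deck_ratFunc {σ : B.FunField →ₐ[ℂ] B.FunField} (h : σ B.t = B.t) (f : RatFunc ℂ) :
    σ (algebraMap (RatFunc ℂ) B.FunField f) = algebraMap (RatFunc ℂ) B.FunField f := by
  rw [map_ratFunc, h, algebraMap_ratFunc]

theorem deck_aeval {σ : B.FunField →ₐ[ℂ] B.FunField} (h : σ B.t = B.t) (p : ℂ[X]) :
    σ (aeval B.t p) = aeval B.t p := by
  rw [← aeval_algHom_apply, h]

omit [NeZero n] in
theorem sum_pow_eq_zero {ζ : ℂ} (hζ : IsPrimitiveRoot ζ n) {k : ℕ} (hk : ¬ n ∣ k) :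
    ∑ i ∈ Finset.range n, (ζ ^ k) ^ i = 0 := by
  have h1 : ζ ^ k ≠ 1 := fun h ↦ hk ((hζ.pow_eq_one_iff_dvd k).1 h)
  rw [geom_sum_eq h1, ← pow_mul, mul_comm, pow_mul, hζ.pow_eq_one, one_pow, sub_self, zero_div]

/-- The trace of an element lies in `ℂ(t)`. -/
theorem exists_sum_deck {ζ : ℂ} (hζ : IsPrimitiveRoot ζ n) {σ : ℕ → B.FunField →ₐ[ℂ] B.FunField}
    (hσ : ∀ i, σ i B.t = B.t ∧ σ i B.z = ζ ^ i • B.z) (q : B.FunField) :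
    ∃ f, ∑ i ∈ Finset.range n, σ i q = algebraMap (RatFunc ℂ) B.FunField f := by
  obtain ⟨h, rfl⟩ := B.exists_repr q
  refine ⟨n * h 0, ?_⟩
  simp only [map_sum, map_mul, map_pow, (hσ _).2, deck_ratFunc (hσ _).1]
  rw [Finset.sum_comm, Finset.sum_eq_single (0 : Fin n)]
  · simp
  · intro k _ hk
    have hk' : ¬ n ∣ (k : ℕ) := Nat.not_dvd_of_pos_of_lt (Nat.pos_of_ne_zero fun h ↦ hk (by
      ext; simpa using h)) k.2
    have := sum_pow_eq_zero hζ hk'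
    rw [← Finset.mul_sum]
    convert mul_zero _
    simp only [_root_.smul_pow]
    rw [← Finset.sum_smul]
    convert zero_smul ℂ _
    rw [← this]
    exact Finset.sum_congr rfl fun i _ ↦ by rw [← pow_mul, ← pow_mul, mul_comm]
  · simp

theorem HasDegLE.sum_deck_eq_zero {r : ℕ} (hr : r + 3 = n) {p : B.FunField} (hp : B.HasDegLE r p)
    {ζ : ℂ} (hζ : IsPrimitiveRoot ζ n) {σ : ℕ → B.FunField →ₐ[ℂ] B.FunField}
    (hσ : ∀ i, σ i B.t = B.t ∧ σ i B.z = ζ ^ i • B.z) :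
    ∑ i ∈ Finset.range n, ζ ^ i • σ i p = 0 := by
  obtain ⟨g, hg, rfl⟩ := hp
  simp only [map_sum, map_mul, map_pow, (hσ _).2, deck_aeval (hσ _).1, Finset.smul_sum]
  rw [Finset.sum_comm]
  refine Finset.sum_eq_zero fun k _ ↦ ?_
  by_cases hk : (k : ℕ) ≤ r
  · have := sum_pow_eq_zero hζ (k := k + 1) (Nat.not_dvd_of_pos_of_lt (by omega) (by omega))
    have h2 : ∀ i, ζ ^ i • (aeval B.t (g k) * (ζ ^ i • B.z) ^ (k : ℕ)) =
        (ζ ^ ((k : ℕ) + 1)) ^ i • (aeval B.t (g k) * B.z ^ (k : ℕ)) := fun i ↦ by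
      rw [_root_.smul_pow, mul_smul_comm, smul_smul, ← pow_mul, ← pow_mul, ← pow_add]
      congr 2
      ring
    simp only [h2]
    rw [← Finset.sum_smul, this, zero_smul]
  · have : g k = 0 := by
      have h1 := hg k
      rw [show r + 1 - (k : ℕ) = 0 by omega, mem_degreeLT, Nat.cast_zero] at h1
      rw [← degree_eq_bot]
      exact Nat.WithBot.lt_zero_iff.1 h1
    simp [this]

/-- Coordinates `x`, `y` on the curve for which some multiple of the canonical series consists of
polynomials of degree at most `n - 3` in `t` and `z`. -/
structure PlaneCoords (B : SplitForm n) (r : ℕ) where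
  /-- The first coordinate. -/
  x : B.FunField
  /-- The second coordinate. -/
  y : B.FunField
  /-- The multiplier. -/
  u : B.FunField
  u_ne_zero : u ≠ 0
  hasDegLE : ∀ i j : ℕ, i + j ≤ r → B.HasDegLE r (u * (x ^ i * y ^ j))
  hom_ext : ∀ f g : B.FunField →ₐ[ℂ] B.FunField, f x = g x → f y = g y → f = g
  indep : ∀ a b c : ℂ, algebraMap ℂ B.FunField a * x + algebraMap ℂ B.FunField b * y +
    algebraMap ℂ B.FunField c = 0 → a = 0 ∧ b = 0 ∧ c = 0

namespace PlaneCoords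

variable {r : ℕ} (W : PlaneCoords B r)

theorem deck_injective {ζ : ℂ} (hζ : IsPrimitiveRoot ζ n) {σ : ℕ → B.FunField →ₐ[ℂ] B.FunField}
    (hσ : ∀ i, σ i B.t = B.t ∧ σ i B.z = ζ ^ i • B.z) {i j : ℕ} (hi : i < n) (hj : j < n)
    (hx : σ i W.x = σ j W.x) (hy : σ i W.y = σ j W.y) : i = j := by
  have h := congr($(W.hom_ext _ _ hx hy) B.z)
  rw [(hσ i).2, (hσ j).2] at h
  exact hζ.pow_inj hi hj (smul_left_injective ℂ B.z_ne_zero h)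

/-- The conjugates of the point `(x, y)` over `ℂ(t)` are collinear. -/
theorem exists_line (hr : r + 3 = n) (hr2 : 2 ≤ r) {ζ : ℂ} (hζ : IsPrimitiveRoot ζ n)
    {σ : ℕ → B.FunField →ₐ[ℂ] B.FunField} (hσ : ∀ i, σ i B.t = B.t ∧ σ i B.z = ζ ^ i • B.z) :
    ∃ l, IsLine l ∧ ∀ i, lineForm l (σ i W.x, σ i W.y) = 0 := by
  classical
  set P : ℕ → B.FunField × B.FunField := fun i ↦ (σ i W.x, σ i W.y) with hP
  set P' : Fin n → B.FunField × B.FunField := fun i ↦ P i with hP'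
  have hinj : Function.Injective P' := fun i j hij ↦ Fin.ext <|
    W.deck_injective hζ hσ i.2 j.2 congr(($hij).1) congr(($hij).2)
  set c := Function.extend P' (fun i ↦ ζ ^ (i : ℕ) • σ i W.u) 0
  have hc : ∀ i, c (P' i) = ζ ^ (i : ℕ) • σ i W.u := fun i ↦ hinj.extend_apply _ _ _
  have hkill : KillsDegLE c (Finset.univ.image P') r := by
    intro i j hij
    rw [Finset.sum_image fun _ _ _ _ h ↦ hinj h]
    have := (W.hasDegLE i j hij).sum_deck_eq_zero hr hζ hσ
    rw [← this, Finset.sum_range]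
    refine Finset.sum_congr rfl fun k _ ↦ ?_
    rw [hc]
    simp [hP', hP]
  obtain ⟨l, hl, hon⟩ := hkill.exists_line (by
    intro p hp
    obtain ⟨i, -, rfl⟩ := Finset.mem_image.1 hp
    rw [hc]
    exact smul_ne_zero (pow_ne_zero _ (hζ.ne_zero (NeZero.ne n)))
      ((_root_.map_ne_zero _).2 W.u_ne_zero)) (by
    refine Finset.card_image_le.trans ?_
    rw [Finset.card_univ, Fintype.card_fin]
    omega)
  refine ⟨l, hl, fun i ↦ ?_⟩
  have h1 : σ i = σ (i % n) := B.algHom_ext (by rw [(hσ _).1, (hσ _).1]) (by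
    rw [(hσ _).2, (hσ _).2, ← pow_eq_pow_mod i hζ.pow_eq_one])
  rw [h1]
  exact hon _ (Finset.mem_image.2 ⟨⟨i % n, Nat.mod_lt _ (NeZero.pos n)⟩, Finset.mem_univ _, rfl⟩)

/-- The coordinates satisfy a linear relation over `ℂ(t)`. -/
theorem exists_ratFunc_relation (hr : r + 3 = n) (hr2 : 2 ≤ r) :
    ∃ l : RatFunc ℂ × RatFunc ℂ × RatFunc ℂ, l ≠ 0 ∧
      algebraMap (RatFunc ℂ) B.FunField l.1 * W.x + algebraMap (RatFunc ℂ) B.FunField l.2.1 * W.y +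
        algebraMap (RatFunc ℂ) B.FunField l.2.2 = 0 := by
  obtain ⟨ζ, hζ⟩ : ∃ ζ : ℂ, IsPrimitiveRoot ζ n :=
    ⟨_, Complex.isPrimitiveRoot_exp n (NeZero.ne n)⟩
  obtain ⟨σ, hσ⟩ := B.exists_deck hζ.pow_eq_one
  obtain ⟨l, hl, hon⟩ := W.exists_line hr hr2 hζ hσ
  obtain ⟨c, hc⟩ : ∃ c, c * l.1 = 1 ∨ c * l.2.1 = 1 := by
    rcases hl with h | h
    · exact ⟨_, Or.inl (inv_mul_cancel₀ h)⟩
    · exact ⟨_, Or.inr (inv_mul_cancel₀ h)⟩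
  obtain ⟨f₁, h₁⟩ := exists_sum_deck hζ hσ (c * l.1)
  obtain ⟨f₂, h₂⟩ := exists_sum_deck hζ hσ (c * l.2.1)
  obtain ⟨f₃, h₃⟩ := exists_sum_deck hζ hσ (c * l.2.2)
  have hn0 : (n : B.FunField) ≠ 0 := by
    have : CharZero B.FunField := algebraRat.charZero _
    exact NeZero.natCast_ne n _
  refine ⟨(f₁, f₂, f₃), ?_, ?_⟩
  · intro h0
    simp only [Prod.mk_eq_zero] at h0
    rcases hc with hc | hc
    · rw [hc, h0.1] at h₁
      simp [hn0] at h₁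
    · rw [hc, h0.2.1] at h₂
      simp [hn0] at h₂
  · rw [← h₁, ← h₂, ← h₃, Finset.sum_mul, Finset.sum_mul, ← Finset.sum_add_distrib,
      ← Finset.sum_add_distrib]
    refine Finset.sum_eq_zero fun j hj ↦ ?_
    have hid : (σ j).comp (σ (n - j)) = AlgHom.id ℂ _ := B.algHom_ext (by simp [(hσ _).1]) (by
      have hj' := Finset.mem_range.1 hj
      rw [AlgHom.comp_apply, (hσ (n - j)).2, map_smul, (hσ j).2, smul_smul, ← pow_add,
        Nat.sub_add_cancel hj'.le, hζ.pow_eq_one, one_smul, AlgHom.id_apply])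
    have hid' : ∀ q, σ j (σ (n - j) q) = q := fun q ↦ DFunLike.congr_fun hid q
    have := congr(σ j (c * $(hon (n - j))))
    rw [lineForm] at this
    simp only [map_mul, map_add, hid', map_zero, mul_zero] at this ⊢
    rw [← this]
    ring

/-- The coordinates satisfy a linear relation with coprime coefficients in `ℂ[t]`. -/
theorem exists_poly_relation (hr : r + 3 = n) (hr2 : 2 ≤ r) :
    ∃ α β γ : ℂ[X], (∃ p q s, p * α + q * β + s * γ = 1) ∧
      aeval B.t α * W.x + aeval B.t β * W.y + aeval B.t γ = 0 := by
  obtain ⟨⟨f₁, f₂, f₃⟩, hne, hrel⟩ := W.exists_ratFunc_relation hr hr2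
  set d := f₁.denom * f₂.denom * f₃.denom with hd
  have hd1 := f₁.denom_ne_zero
  have hd2 := f₂.denom_ne_zero
  have hd3 := f₃.denom_ne_zero
  set α := f₁.num * f₂.denom * f₃.denom with hα
  set β := f₂.num * f₁.denom * f₃.denom with hβ
  set γ := f₃.num * f₁.denom * f₂.denom with hγ
  have hrel' : aeval B.t α * W.x + aeval B.t β * W.y + aeval B.t γ = 0 := by
    have h1 := B.aeval_t_ne_zero hd1
    have h2 := B.aeval_t_ne_zero hd2
    have h3 := B.aeval_t_ne_zero hd3
    rw [algebraMap_ratFunc, algebraMap_ratFunc, algebraMap_ratFunc] at hrel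
    simp only [hα, hβ, hγ, map_mul]
    field_simp at hrel
    linear_combination hrel
  obtain ⟨δ, hδ⟩ := (IsPrincipalIdealRing.principal (Ideal.span {α, β, γ})).principal
  have hδ' : Ideal.span {α, β, γ} = Ideal.span {δ} := hδ
  have hmem : ∀ a ∈ ({α, β, γ} : Set ℂ[X]), δ ∣ a := fun a ha ↦ by
    rw [← Ideal.mem_span_singleton, ← hδ']
    exact Ideal.subset_span ha
  obtain ⟨α', h1⟩ := hmem α (by simp)
  obtain ⟨β', h2⟩ := hmem β (by simp)
  obtain ⟨γ', h3⟩ := hmem γ (by simp)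
  have hδ0 : δ ≠ 0 := by
    rintro rfl
    simp only [zero_mul] at h1 h2 h3
    apply hne
    have e1 : f₁ = 0 := by
      rw [← RatFunc.num_eq_zero_iff]
      simpa [hd2, hd3] using hα.symm.trans h1
    have e2 : f₂ = 0 := by
      rw [← RatFunc.num_eq_zero_iff]
      simpa [hd1, hd3] using hβ.symm.trans h2
    have e3 : f₃ = 0 := by
      rw [← RatFunc.num_eq_zero_iff]
      simpa [hd2, hd1] using hγ.symm.trans h3
    rw [e1, e2, e3]
    rfl
  refine ⟨α', β', γ', ?_, ?_⟩
  · have : δ ∈ Ideal.span {α, β, γ} := hδ' ▸ Ideal.mem_span_singleton_self δ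
    obtain ⟨p, q, s, hpqs⟩ := Submodule.mem_span_triple.1 this
    refine ⟨p, q, s, mul_left_cancel₀ hδ0 ?_⟩
    rw [h1, h2, h3] at hpqs
    simp only [smul_eq_mul] at hpqs
    linear_combination hpqs
  · refine (mul_eq_zero.1 ?_).resolve_left (B.aeval_t_ne_zero hδ0)
    rw [← hrel', h1, h2, h3, map_mul, map_mul, map_mul]
    ring

end PlaneCoords

end SplitForm

end Polynomial

namespace Polynomial

theorem natDegree_det_le {m : ℕ} (G : Matrix (Fin m) (Fin m) ℂ[X]) (d : Fin m → ℕ)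
    (h : ∀ i k, (G i k).natDegree ≤ d k) : G.det.natDegree ≤ ∑ k, d k := by
  rw [Matrix.det_apply]
  refine natDegree_sum_le_of_forall_le _ _ fun τ _ ↦ ?_
  have h1 : (∏ i, G (τ i) i).natDegree ≤ ∑ k, d k :=
    (natDegree_prod_le _ _).trans (Finset.sum_le_sum fun i _ ↦ h _ _)
  rcases Int.units_eq_one_or (Equiv.Perm.sign τ) with hs | hs <;> simpa [hs] using h1

namespace SplitForm

variable {n : ℕ} {B : SplitForm n} [NeZero n]

theorem HasDegLE.exists_range {r : ℕ} (hr : r < n) {p : B.FunField} (h : B.HasDegLE r p) :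
    ∃ g : ℕ → ℂ[X], (∀ k, g k ∈ degreeLT ℂ (r + 1 - k)) ∧
      p = ∑ k ∈ Finset.range (r + 1), aeval B.t (g k) * B.z ^ k := by
  obtain ⟨g, hg, rfl⟩ := h
  have hzero : ∀ k : Fin n, r < k → g k = 0 := fun k hk ↦ by
    have h1 := hg k
    rw [show r + 1 - (k : ℕ) = 0 by omega, mem_degreeLT, Nat.cast_zero] at h1
    rw [← degree_eq_bot]
    exact Nat.WithBot.lt_zero_iff.1 h1
  refine ⟨fun k ↦ if hk : k < n then g ⟨k, hk⟩ else 0, fun k ↦ ?_, ?_⟩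
  · dsimp only
    split_ifs with hk
    · exact hg ⟨k, hk⟩
    · exact zero_mem _
  · rw [Finset.sum_subset (Finset.range_subset_range.2 (show r + 1 ≤ n from hr)), Finset.sum_range]
    · simp
    · intro k hk hk'
      rw [Finset.mem_range] at hk hk'
      simp [hk, hzero ⟨k, hk⟩ (by simpa using hk')]

/-- The determinant of the conjugates of a degree `r` linear system. -/
theorem exists_minor_pow_eq {r : ℕ} (hr : r < n) {ζ : ℂ} {σ : ℕ → B.FunField →ₐ[ℂ] B.FunField}
    (hσ : ∀ i, σ i B.t = B.t ∧ σ i B.z = ζ ^ i • B.z)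
    {u x y l : B.FunField} {κ : ℕ → ℕ → B.FunField}
    (h : ∀ i j : ℕ, i + j ≤ r → B.HasDegLE r (u * (x ^ i * y ^ j)))
    (hκ : ∀ i j, σ j x * σ i y - σ i x * σ j y = κ i j * l) :
    ∃ A : ℂ[X], A.natDegree ≤ ∑ k : Fin (r + 1), (r - (k : ℕ)) ∧
      (∏ i : Fin (r + 1), σ i u) * (∏ i : Fin (r + 1), ∏ j ∈ Finset.Ioi i, κ i j) *
        l ^ (∑ k : Fin (r + 1), (r - (k : ℕ))) =
      (Matrix.vandermonde fun i : Fin (r + 1) ↦ σ i B.z).det * aeval B.t A := by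
  have hg' : ∀ j : Fin (r + 1), ∃ g : ℕ → ℂ[X], (∀ k, g k ∈ degreeLT ℂ (r + 1 - k)) ∧
      u * (x ^ (j : ℕ) * y ^ (j.rev : ℕ)) = ∑ k ∈ Finset.range (r + 1), aeval B.t (g k) * B.z ^ k :=
    fun j ↦ (h j j.rev (by rw [Fin.val_rev]; omega)).exists_range hr
  choose g hg hgeq using hg'
  let G : Matrix (Fin (r + 1)) (Fin (r + 1)) ℂ[X] := Matrix.of fun j k ↦ g j k
  refine ⟨G.det, natDegree_det_le _ _ fun i k ↦ ?_, ?_⟩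
  · have h1 := hg i k
    rw [mem_degreeLT] at h1
    by_cases h0 : g i k = 0
    · simp [G, h0]
    · rw [degree_eq_natDegree h0, Nat.cast_lt] at h1
      have := k.2
      change (g i k).natDegree ≤ _
      omega
  · have hmat : Matrix.diagonal (fun i : Fin (r + 1) ↦ σ i u) *
        Matrix.projVandermonde (fun i : Fin (r + 1) ↦ σ i x) (fun i : Fin (r + 1) ↦ σ i y) =
        Matrix.vandermonde (fun i : Fin (r + 1) ↦ σ i B.z) *
          (((aeval B.t : ℂ[X] →ₐ[ℂ] B.FunField) : ℂ[X] →+* B.FunField).mapMatrix G).transpose := by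
      ext i j
      rw [Matrix.diagonal_mul, Matrix.projVandermonde_apply, Matrix.mul_apply, ← map_pow, ← map_pow,
        ← map_mul, ← map_mul, hgeq, map_sum, Finset.sum_range]
      refine Finset.sum_congr rfl fun k _ ↦ ?_
      rw [map_mul, deck_aeval (hσ _).1, map_pow, Matrix.vandermonde_apply, mul_comm]
      rfl
    have hdet := congr(Matrix.det $hmat)
    rw [Matrix.det_mul, Matrix.det_diagonal, Matrix.det_projVandermonde, Matrix.det_mul,
      Matrix.det_transpose, ← RingHom.map_det] at hdet
    simp only [RingHom.coe_coe] at hdet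
    rw [← hdet]
    simp only [hκ, Finset.prod_mul_distrib, Finset.prod_const, Finset.prod_pow_eq_pow_sum]
    have hcard : ∀ k : Fin (r + 1), (Finset.Ioi k).card = r - (k : ℕ) := fun k ↦ by
      rw [Fin.card_Ioi]; omega
    simp only [hcard]
    ring

namespace PlaneCoords

variable {r : ℕ} (W : PlaneCoords B r)

theorem exists_linear_relation (hr : r + 3 = n) (hr2 : 2 ≤ r) :
    ∃ α β γ : ℂ[X], (∃ p q s, p * α + q * β + s * γ = 1) ∧
      aeval B.t α * W.x + aeval B.t β * W.y + aeval B.t γ = 0 ∧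
      α.natDegree ≤ 1 ∧ β.natDegree ≤ 1 ∧ γ.natDegree ≤ 1 := by
  obtain ⟨α, β, γ, ⟨p, q, s, hpqs⟩, hrel⟩ := W.exists_poly_relation hr hr2
  refine ⟨α, β, γ, ⟨p, q, s, hpqs⟩, hrel, ?_⟩
  obtain ⟨ζ, hζ⟩ : ∃ ζ : ℂ, IsPrimitiveRoot ζ n :=
    ⟨_, Complex.isPrimitiveRoot_exp n (NeZero.ne n)⟩
  obtain ⟨σ, hσ⟩ := B.exists_deck hζ.pow_eq_one
  have hrelσ : ∀ i, aeval B.t α * σ i W.x + aeval B.t β * σ i W.y + aeval B.t γ = 0 := fun i ↦ by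
    have := congr(σ i $hrel)
    simpa only [map_add, map_mul, deck_aeval (hσ i).1, map_zero] using this
  have hpqs' := congr(aeval B.t $hpqs)
  simp only [map_add, map_mul, map_one] at hpqs'
  have hunit : (∃ P Q S : ℂ[X], ∀ N, N = ∑ k : Fin (r + 1), (r - (k : ℕ)) →
      P * α ^ N + Q * β ^ N + S * γ ^ N = 1) := by
    have hspan : Ideal.span ({α, β, γ} : Set ℂ[X]) = ⊤ := by
      rw [Ideal.eq_top_iff_one, Ideal.span, Submodule.mem_span_triple]
      exact ⟨p, q, s, hpqs⟩
    have := Ideal.span_pow_eq_top _ hspan (∑ k : Fin (r + 1), (r - (k : ℕ)))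
    rw [Set.image_insert_eq, Set.image_pair, Ideal.eq_top_iff_one, Ideal.span,
      Submodule.mem_span_triple] at this
    obtain ⟨P, Q, S, h⟩ := this
    exact ⟨P, Q, S, fun N hN ↦ by rw [hN]; exact h⟩
  obtain ⟨P, Q, S, hPQS⟩ := hunit
  obtain ⟨N, hN⟩ : ∃ N, N = ∑ k : Fin (r + 1), (r - (k : ℕ)) := ⟨_, rfl⟩
  specialize hPQS N hN
  have hNpos : 0 < N := by
    rw [hN]
    refine Finset.sum_pos' (fun _ _ ↦ Nat.zero_le _) ⟨0, Finset.mem_univ _, ?_⟩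
    simpa using by omega
  set a := aeval B.t α
  set b := aeval B.t β
  set c := aeval B.t γ
  set κ : ℕ → ℕ → B.FunField := fun i j ↦
    aeval B.t p * (σ j W.y * 1 - σ i W.y * 1) + aeval B.t q * (1 * σ i W.x - 1 * σ j W.x) +
      aeval B.t s * (σ j W.x * σ i W.y - σ i W.x * σ j W.y) with hκ
  have hka : ∀ i j, σ j W.y * σ i 1 - σ i W.y * σ j 1 = κ i j * a := fun i j ↦ by
    rw [map_one, map_one, hκ]
    have hi := hrelσ i
    have hj := hrelσ j
    linear_combination (-(σ j W.y - σ i W.y)) * hpqs' + aeval B.t q * (hj - hi) +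
      aeval B.t s * (σ j W.y * hi - σ i W.y * hj)
  have hkb : ∀ i j, σ j 1 * σ i W.x - σ i 1 * σ j W.x = κ i j * b := fun i j ↦ by
    rw [map_one, map_one, hκ]
    have hi := hrelσ i
    have hj := hrelσ j
    linear_combination (-(σ i W.x - σ j W.x)) * hpqs' + aeval B.t p * (hi - hj) +
      aeval B.t s * (σ i W.x * hj - σ j W.x * hi)
  have hkc : ∀ i j, σ j W.x * σ i W.y - σ i W.x * σ j W.y = κ i j * c := fun i j ↦ by
    rw [hκ]
    have hi := hrelσ i
    have hj := hrelσ j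
    linear_combination (-(σ j W.x * σ i W.y - σ i W.x * σ j W.y)) * hpqs' +
      aeval B.t p * (σ i W.y * hj - σ j W.y * hi) + aeval B.t q * (σ j W.x * hi - σ i W.x * hj)
  have hκ0 : ∀ i j : Fin (r + 1), i < j → κ i j ≠ 0 := by
    intro i j hij h0
    have h1 := hka i j
    have h2 := hkb i j
    rw [h0, zero_mul, map_one, map_one] at h1 h2
    have := W.deck_injective hζ hσ (i := i) (j := j) (by omega) (by omega)
      (by linear_combination h2) (by linear_combination -h1)
    exact hij.ne (Fin.ext this)
  have hr' : r < n := by omega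
  obtain ⟨A, hA, hAeq⟩ := exists_minor_pow_eq hr' hσ (u := W.u) (x := W.y) (y := 1)
    (fun i j hij ↦ by simpa using W.hasDegLE 0 i (by omega)) hka
  obtain ⟨A', hA', hAeq'⟩ := exists_minor_pow_eq hr' hσ (u := W.u) (x := 1) (y := W.x)
    (fun i j hij ↦ by simpa using W.hasDegLE j 0 (by omega)) hkb
  obtain ⟨A'', hA'', hAeq''⟩ := exists_minor_pow_eq hr' hσ (u := W.u) (x := W.x) (y := W.y)
    W.hasDegLE hkc
  have hV : (Matrix.vandermonde fun i : Fin (r + 1) ↦ σ i B.z).det ≠ 0 := by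
    rw [Matrix.det_vandermonde_ne_zero_iff]
    intro i j hij
    simp only [(hσ _).2] at hij
    exact Fin.ext (hζ.pow_inj (by omega) (by omega) (smul_left_injective ℂ B.z_ne_zero hij))
  have hE : (∏ i : Fin (r + 1), σ i W.u) * (∏ i : Fin (r + 1), ∏ j ∈ Finset.Ioi i, κ i j) ≠ 0 :=
    mul_ne_zero (Finset.prod_ne_zero_iff.2 fun i _ ↦ (_root_.map_ne_zero _).2 W.u_ne_zero)
      (Finset.prod_ne_zero_iff.2 fun i _ ↦ Finset.prod_ne_zero_iff.2 fun j hj ↦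
        hκ0 i j (Finset.mem_Ioi.1 hj))
  rw [← hN] at hA hA' hA'' hAeq hAeq' hAeq''
  generalize (∏ i : Fin (r + 1), σ i W.u) *
    (∏ i : Fin (r + 1), ∏ j ∈ Finset.Ioi i, κ i j) = E at *
  generalize (Matrix.vandermonde fun i : Fin (r + 1) ↦ σ i B.z).det = V at *
  set e := P * A + Q * A' + S * A'' with he
  have hEe : E = V * aeval B.t e := by
    have h1 := congr(aeval B.t $hPQS)
    simp only [map_add, map_mul, map_one, map_pow] at h1
    rw [he]
    simp only [map_add, map_mul]
    linear_combination (-E) * h1 + aeval B.t P * hAeq + aeval B.t Q * hAeq' + aeval B.t S * hAeq''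
  have he0 : e ≠ 0 := fun h0 ↦ hE (by rw [hEe, h0, map_zero, mul_zero])
  have hfin : ∀ α A : ℂ[X], A.natDegree ≤ N → E * (aeval B.t α) ^ N = V * aeval B.t A →
      α.natDegree ≤ 1 := by
    intro α A hA h
    have h1 : e * α ^ N = A := by
      by_contra hne
      refine B.aeval_t_ne_zero (sub_ne_zero.2 hne) (mul_left_cancel₀ hV ?_)
      rw [map_sub, map_mul, map_pow]
      linear_combination h - aeval B.t α ^ N * hEe
    by_cases hα : α = 0
    · simp [hα]
    · rw [← h1, natDegree_mul he0 (pow_ne_zero _ hα), natDegree_pow] at hA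
      exact Nat.le_of_mul_le_mul_left (by omega : N * α.natDegree ≤ N * 1) hNpos
  exact ⟨hfin α A hA hAeq, hfin β A' hA' hAeq', hfin γ A'' hA'' hAeq''⟩

end PlaneCoords

end SplitForm

end Polynomial

namespace Polynomial

namespace SplitForm

variable {n : ℕ} {B : SplitForm n} [NeZero n]

theorem HasDegLE.add {r : ℕ} {p q : B.FunField} (hp : B.HasDegLE r p) (hq : B.HasDegLE r q) :
    B.HasDegLE r (p + q) := by
  obtain ⟨g, hg, rfl⟩ := hp
  obtain ⟨h, hh, rfl⟩ := hq
  refine ⟨g + h, fun k ↦ add_mem (hg k) (hh k), ?_⟩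
  rw [← Finset.sum_add_distrib]
  exact Finset.sum_congr rfl fun k _ ↦ by rw [Pi.add_apply, map_add, add_mul]

theorem HasDegLE.smul {r : ℕ} {p : B.FunField} (hp : B.HasDegLE r p) (c : ℂ) :
    B.HasDegLE r (algebraMap ℂ B.FunField c * p) := by
  obtain ⟨g, hg, rfl⟩ := hp
  refine ⟨c • g, fun k ↦ Submodule.smul_mem _ _ (hg k), ?_⟩
  rw [Finset.mul_sum]
  refine Finset.sum_congr rfl fun k _ ↦ ?_
  rw [Pi.smul_apply, map_smul, Algebra.smul_def, mul_assoc]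

theorem poly_repr_unique {g h : Fin n → ℂ[X]}
    (e : ∑ k, aeval B.t (g k) * B.z ^ (k : ℕ) = ∑ k, aeval B.t (h k) * B.z ^ (k : ℕ)) :
    g = h := by
  simp only [aeval_t] at e
  have := B.repr_unique (g := fun k ↦ algebraMap _ _ (g k)) (h := fun k ↦ algebraMap _ _ (h k)) e
  funext k
  exact RatFunc.algebraMap_injective ℂ (congr_fun this k)

theorem HasDegLE.of_mul_t_pow {r j : ℕ} (hj : j ≤ r) {p : B.FunField} (hp : B.HasDegLE r p)
    (hpt : B.HasDegLE r (p * B.t ^ j)) : B.HasDegLE (r - j) p := by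
  obtain ⟨g, hg, rfl⟩ := hp
  obtain ⟨h, hh, e⟩ := hpt
  refine ⟨g, fun k ↦ ?_, rfl⟩
  have e' : (fun k ↦ g k * X ^ j) = h := by
    refine poly_repr_unique (B := B) ?_
    rw [← e, Finset.sum_mul]
    refine Finset.sum_congr rfl fun k _ ↦ ?_
    rw [map_mul, map_pow, aeval_X]
    ring
  have h1 := hh k
  rw [← congr_fun e' k, mem_degreeLT] at h1
  rw [mem_degreeLT]
  by_cases h0 : g k = 0
  · rw [h0, degree_zero]
    exact WithBot.bot_lt_coe _
  · rw [degree_mul, degree_X_pow, degree_eq_natDegree h0, ← Nat.cast_add, Nat.cast_lt] at h1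
    rw [degree_eq_natDegree h0, Nat.cast_lt]
    omega

theorem natDegree_le_of_mem_degreeLT {m : ℕ} {p : ℂ[X]} (hp : p ∈ degreeLT ℂ (m + 1)) :
    p.natDegree ≤ m := by
  by_cases h0 : p = 0
  · simp [h0]
  · rw [mem_degreeLT, degree_eq_natDegree h0, Nat.cast_lt] at hp
    omega

theorem HasDegLE.exists_const (hn : 2 ≤ n) {p : B.FunField} (hp : B.HasDegLE 0 p) :
    ∃ a : ℂ, p = algebraMap ℂ B.FunField a := by
  obtain ⟨g, hg, rfl⟩ := hp.exists_range (by omega)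
  have h0 := hg 0
  refine ⟨(g 0).coeff 0, ?_⟩
  rw [Finset.sum_range_one, pow_zero, mul_one]
  conv_lhs => rw [eq_C_of_natDegree_le_zero (natDegree_le_of_mem_degreeLT h0), aeval_C]

theorem HasDegLE.exists_linear (hn : 2 ≤ n) {p : B.FunField} (hp : B.HasDegLE 1 p) :
    ∃ a b c : ℂ, p = algebraMap ℂ B.FunField a * B.t + algebraMap ℂ B.FunField b +
      algebraMap ℂ B.FunField c * B.z := by
  obtain ⟨g, hg, rfl⟩ := hp.exists_range (by omega)
  have h0 := hg 0
  have h1 := hg 1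
  have e0 := eq_X_add_C_of_natDegree_le_one (natDegree_le_of_mem_degreeLT h0)
  have e1 := eq_C_of_natDegree_le_zero (natDegree_le_of_mem_degreeLT h1)
  refine ⟨(g 0).coeff 1, (g 0).coeff 0, (g 1).coeff 0, ?_⟩
  rw [Finset.sum_range_succ, Finset.sum_range_one]
  conv_lhs => rw [e0, e1]
  simp

namespace PlaneCoords

variable {r : ℕ} (W : PlaneCoords B r)

/-- Elements which behave like polynomials of degree `k` in the coordinates. -/
def Deg (k : ℕ) (f : B.FunField) : Prop :=
  ∀ i j : ℕ, i + j + k ≤ r → B.HasDegLE r (W.u * f * (W.x ^ i * W.y ^ j))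

/-- A linear form in the coordinates. -/
noncomputable def lin (a b c : ℂ) : B.FunField :=
  algebraMap ℂ B.FunField a * W.x + algebraMap ℂ B.FunField b * W.y + algebraMap ℂ B.FunField c

variable {W}

theorem deg_one : W.Deg 0 1 := fun i j hij ↦ by
  simpa using W.hasDegLE i j hij

theorem Deg.mul_lin {k : ℕ} {f : B.FunField} (hf : W.Deg k f) (a b c : ℂ) :
    W.Deg (k + 1) (f * W.lin a b c) := fun i j hij ↦ by
  have h1 := (hf (i + 1) j (by omega)).smul a
  have h2 := (hf i (j + 1) (by omega)).smul b
  have h3 := (hf i j (by omega)).smul c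
  convert (h1.add h2).add h3 using 1
  rw [lin]
  ring

theorem Deg.mul_lin_pow {k : ℕ} {f : B.FunField} (hf : W.Deg k f) (a b c : ℂ) (m : ℕ) :
    W.Deg (k + m) (f * W.lin a b c ^ m) := by
  induction m with
  | zero => simpa using hf
  | succ m ih =>
    rw [pow_succ, ← mul_assoc, ← add_assoc]
    exact ih.mul_lin a b c

theorem Deg.hasDegLE {k : ℕ} {f : B.FunField} (hf : W.Deg k f) (hk : k ≤ r) :
    B.HasDegLE r (W.u * f) := by
  simpa using hf 0 0 (by omega)

variable (W)

theorem exists_moebius (hr : r + 3 = n) (hr2 : 2 ≤ r) :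
    ∃ α : Fin 3 → ℂ, ∃ β : Fin 3 → ℂ, W.lin (α 0) (α 1) (α 2) ≠ 0 ∧
      W.lin (β 0) (β 1) (β 2) = - (B.t * W.lin (α 0) (α 1) (α 2)) := by
  obtain ⟨α, β, γ, ⟨p, q, s, hpqs⟩, hrel, hα, hβ, hγ⟩ := W.exists_linear_relation hr hr2
  have eα := eq_X_add_C_of_natDegree_le_one hα
  have eβ := eq_X_add_C_of_natDegree_le_one hβ
  have eγ := eq_X_add_C_of_natDegree_le_one hγ
  rw [eα, eβ, eγ] at hrel
  simp only [map_add, map_mul, aeval_C, aeval_X] at hrel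
  have hrel' : W.lin (α.coeff 0) (β.coeff 0) (γ.coeff 0) =
      - (B.t * W.lin (α.coeff 1) (β.coeff 1) (γ.coeff 1)) := by
    rw [lin, lin]
    linear_combination hrel
  refine ⟨![α.coeff 1, β.coeff 1, γ.coeff 1], ![α.coeff 0, β.coeff 0, γ.coeff 0], ?_, hrel'⟩
  intro h1
  change W.lin (α.coeff 1) (β.coeff 1) (γ.coeff 1) = 0 at h1
  rw [h1, mul_zero, neg_zero] at hrel'
  obtain ⟨a1, b1, c1⟩ := W.indep _ _ _ h1
  obtain ⟨a0, b0, c0⟩ := W.indep _ _ _ hrel'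
  rw [eα, eβ, eγ, a1, b1, c1, a0, b0, c0] at hpqs
  simp at hpqs

/-- The coordinates are related to `(t, z)` by a projective transformation. -/
theorem exists_projective (hr : r + 3 = n) (hr2 : 2 ≤ r) :
    ∃ (M : Matrix (Fin 3) (Fin 3) ℂ) (w : B.FunField), M.det ≠ 0 ∧ w ≠ 0 ∧
      ∀ i, ![W.x, 1, W.y] i = w * (algebraMap ℂ B.FunField (M i 0) * B.t +
        algebraMap ℂ B.FunField (M i 1) + algebraMap ℂ B.FunField (M i 2) * B.z) := by
  obtain ⟨α, β, hw, hβ⟩ := W.exists_moebius hr hr2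
  set w := W.lin (α 0) (α 1) (α 2) with hwdef
  have hconst : ∃ c : ℂ, W.u * w ^ r = algebraMap ℂ B.FunField c := by
    refine HasDegLE.exists_const (by omega) ?_
    have h1 := (deg_one (W := W)).mul_lin_pow (α 0) (α 1) (α 2) r
    have h2 := (deg_one (W := W)).mul_lin_pow (β 0) (β 1) (β 2) r
    rw [zero_add, one_mul] at h1 h2
    have h3 := HasDegLE.of_mul_t_pow (j := r) le_rfl (h1.hasDegLE le_rfl) (by
      have := (h2.hasDegLE le_rfl).smul ((-1) ^ r)
      rw [hβ] at this
      convert this using 1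
      rw [map_pow, map_neg, map_one, ← hwdef]
      calc W.u * w ^ r * B.t ^ r = W.u * (B.t * w) ^ r := by ring
        _ = W.u * ((-1) * (-(B.t * w))) ^ r := by congr 2; ring
        _ = _ := by rw [mul_pow]; ring)
    rwa [Nat.sub_self] at h3
  obtain ⟨c, hc⟩ := hconst
  have hc0 : c ≠ 0 := by
    rintro rfl
    rw [map_zero] at hc
    exact mul_ne_zero W.u_ne_zero (pow_ne_zero _ hw) hc
  have hc0' : algebraMap ℂ B.FunField c ≠ 0 := by simpa using hc0
  have hlin : ∀ a b d : ℂ, ∃ m : Fin 3 → ℂ, W.lin a b d = w * (algebraMap ℂ B.FunField (m 0) * B.t +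
        algebraMap ℂ B.FunField (m 1) + algebraMap ℂ B.FunField (m 2) * B.z) := by
    intro a b d
    have h0 := (deg_one (W := W)).mul_lin a b d
    have h1 := h0.mul_lin_pow (α 0) (α 1) (α 2) (r - 1)
    have h2 := h0.mul_lin_pow (β 0) (β 1) (β 2) (r - 1)
    rw [one_mul, zero_add] at h1 h2
    have h3 := HasDegLE.of_mul_t_pow (j := r - 1) (by omega) (h1.hasDegLE (by omega)) (by
      have := (h2.hasDegLE (by omega)).smul ((-1) ^ (r - 1))
      rw [hβ] at this
      convert this using 1
      rw [map_pow, map_neg, map_one, ← hwdef]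
      calc W.u * (W.lin a b d * w ^ (r - 1)) * B.t ^ (r - 1) =
            W.u * W.lin a b d * (B.t * w) ^ (r - 1) := by ring
        _ = W.u * W.lin a b d * ((-1) * (-(B.t * w))) ^ (r - 1) := by congr 2; ring
        _ = _ := by rw [mul_pow]; ring)
    rw [show r - (r - 1) = 1 by omega] at h3
    obtain ⟨m₀, m₁, m₂, hm⟩ := h3.exists_linear (by omega)
    refine ⟨![m₀ / c, m₁ / c, m₂ / c], ?_⟩
    have hm' : algebraMap ℂ B.FunField c * W.lin a b d = w * (algebraMap ℂ B.FunField m₀ * B.t +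
        algebraMap ℂ B.FunField m₁ + algebraMap ℂ B.FunField m₂ * B.z) := by
      rw [← hm, ← hc]
      obtain ⟨r', rfl⟩ : ∃ r', r = r' + 1 := ⟨r - 1, by omega⟩
      rw [Nat.add_sub_cancel, ← hwdef]
      ring
    simp only [Matrix.cons_val_zero, Matrix.cons_val_one, Matrix.cons_val, map_div₀]
    field_simp
    linear_combination hm'
  obtain ⟨mx, hx⟩ := hlin 1 0 0
  obtain ⟨m1, h1⟩ := hlin 0 0 1
  obtain ⟨my, hy⟩ := hlin 0 1 0
  simp only [lin, map_one, map_zero, one_mul, zero_mul, add_zero, zero_add] at hx h1 hy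
  refine ⟨![mx, m1, my], w, ?_, hw, ?_⟩
  · intro hdet
    obtain ⟨v, hv, hv0⟩ := Matrix.exists_vecMul_eq_zero_iff.2 hdet
    have h := fun j ↦ congr(algebraMap ℂ B.FunField $(congr_fun hv0 j))
    simp only [Matrix.vecMul, dotProduct, Fin.sum_univ_three, map_add, map_mul, Pi.zero_apply,
      map_zero, Matrix.cons_val_zero, Matrix.cons_val_one, Matrix.cons_val] at h
    have e0 := h 0
    have e1 := h 1
    have e2 := h 2
    obtain ⟨a, b, d⟩ := W.indep (v 0) (v 2) (v 1) (by
      rw [hx, hy]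
      have h1' := h1
      linear_combination (algebraMap ℂ B.FunField (v 1)) * h1 + w * B.t * e0 + w * e1 +
        w * B.z * e2)
    apply hv
    ext i
    fin_cases i
    · exact a
    · exact d
    · exact b
  · intro i
    fin_cases i
    · exact hx
    · exact h1
    · exact hy

end PlaneCoords

/-- An isomorphism of function fields preserving the canonical series gives plane coordinates. -/
theorem exists_planeCoords {r : ℕ} (hr : r + 3 = n) {B' : SplitForm n}
    (θ : B'.FunField ≃ₐ[ℂ] B.FunField) :
    ∃ W : PlaneCoords B r, W.x = θ B'.t ∧ W.y = θ B'.z := by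
  obtain ⟨u, hu, h⟩ := exists_multiplier (by omega) θ
  refine ⟨⟨θ B'.t, θ B'.z, u, hu, fun i j hij ↦ ?_, fun f g hx hy ↦ ?_, fun a b c habc ↦ ?_⟩,
    rfl, rfl⟩
  · have := h i j (by omega)
    rwa [show n - 3 = r by omega] at this
  · have : f.comp θ.toAlgHom = g.comp θ.toAlgHom := B'.algHom_ext hx hy
    refine AlgHom.ext fun q ↦ ?_
    have := DFunLike.congr_fun this (θ.symm q)
    change f (θ (θ.symm q)) = g (θ (θ.symm q)) at this
    rwa [θ.apply_symm_apply] at this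
  · have h1 : algebraMap ℂ B'.FunField a * B'.t + algebraMap ℂ B'.FunField b * B'.z +
        algebraMap ℂ B'.FunField c = 0 := by
      apply θ.injective
      simpa using habc
    have hn : 1 < n := by omega
    let g : Fin n → ℂ[X] := fun k ↦ if (k : ℕ) = 0 then C a * X + C c else if (k : ℕ) = 1 then C b
      else 0
    have hg : g = 0 := by
      refine poly_repr_unique (B := B') ?_
      simp only [Pi.zero_apply, map_zero, zero_mul, Finset.sum_const_zero]
      rw [← h1, Finset.sum_eq_add (⟨0, by omega⟩ : Fin n) (⟨1, hn⟩ : Fin n) (by simp)]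
      · simp [g]
        ring
      · rintro k - ⟨hk0, hk1⟩
        have hk0' : (k : ℕ) ≠ 0 := fun h ↦ hk0 (Fin.ext h)
        have hk1' : (k : ℕ) ≠ 1 := fun h ↦ hk1 (Fin.ext h)
        simp only [g, if_neg hk0', if_neg hk1', map_zero, zero_mul]
      · simp
      · simp
    have g0 := congr_fun hg ⟨0, by omega⟩
    have g1 := congr_fun hg ⟨1, hn⟩
    simp only [g, if_true, Pi.zero_apply, one_ne_zero, if_false] at g0 g1
    have c0 := congr(coeff $g0 0)
    have c1 := congr(coeff $g0 1)
    simp at c0 c1 g1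
    exact ⟨c1, g1, c0⟩

end SplitForm

end Polynomial

namespace Polynomial

namespace SplitForm

variable {n : ℕ} (B : SplitForm n)

/-- The equation `B(x, y) = 1` of the affine part of the curve `B(X, Y) = Z ^ n`. -/
noncomputable def affine : MvPolynomial (Fin 2) ℂ :=
  MvPolynomial.C B.lead *
    ∏ s ∈ B.roots, (MvPolynomial.X 0 - MvPolynomial.C s * MvPolynomial.X 1) - 1

/-- The polynomial describing the curve in the chart where the root `s₀` is at infinity. -/
noncomputable def chart (s₀ : ℂ) : ℂ[X] :=
  C B.lead * ∏ s ∈ B.roots.erase s₀, (1 + C (s₀ - s) * X)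

theorem pow_eq_chart {R : Type*} [CommRing R] [Algebra ℂ R] {x y w : R} {s₀ : ℂ}
    (hs₀ : s₀ ∈ B.roots) (h1 : (x - algebraMap ℂ R s₀ * y) * w = 1)
    (hw : w = algebraMap ℂ R B.lead * ∏ s ∈ B.roots.erase s₀, (x - algebraMap ℂ R s * y)) :
    w ^ n = aeval (y * w) (B.chart s₀) := by
  have hcard : n = (B.roots.erase s₀).card + 1 := by
    rw [Finset.card_erase_add_one hs₀, B.card_roots]
  conv_lhs => rw [hcard, pow_succ]; enter [2]; rw [hw]
  rw [chart, map_mul, aeval_C, map_prod, mul_left_comm, ← Finset.prod_const,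
    ← Finset.prod_mul_distrib]
  congr 1
  refine Finset.prod_congr rfl fun r _ ↦ ?_
  simp only [map_add, map_one, map_mul, aeval_C, aeval_X, map_sub]
  linear_combination h1

theorem exists_mul_eq_one {R : Type*} [CommRing R] [Algebra ℂ R] {x y : R} {s₀ : ℂ}
    (hs₀ : s₀ ∈ B.roots)
    (h : algebraMap ℂ R B.lead * ∏ s ∈ B.roots, (x - algebraMap ℂ R s * y) = 1) :
    ∃ w, (x - algebraMap ℂ R s₀ * y) * w = 1 ∧ w ^ n = aeval (y * w) (B.chart s₀) := by
  have h1 : (x - algebraMap ℂ R s₀ * y) *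
      (algebraMap ℂ R B.lead * ∏ s ∈ B.roots.erase s₀, (x - algebraMap ℂ R s * y)) = 1 := by
    rw [← h, ← Finset.mul_prod_erase _ _ hs₀]
    ring
  exact ⟨_, h1, B.pow_eq_chart hs₀ h1 rfl⟩

omit B n in
theorem exists_aevalAeval_eq (s₀ : ℂ) (Q : MvPolynomial (Fin 2) ℂ) :
    ∃ (k : ℕ) (P : ℂ[X][X]), ∀ {R : Type} [CommRing R] [Algebra ℂ R] (x y w : R),
      (x - algebraMap ℂ R s₀ * y) * w = 1 →
        w ^ k * MvPolynomial.aeval ![x, y] Q = aevalAeval (y * w) w P := by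
  induction Q using MvPolynomial.induction_on with
  | C a =>
    refine ⟨0, C (C a), fun {R} _ _ x y w h ↦ ?_⟩
    simp
  | add p q hp hq =>
    obtain ⟨k, P, hP⟩ := hp
    obtain ⟨l, Q, hQ⟩ := hq
    refine ⟨k + l, X ^ l * P + X ^ k * Q, fun {R} _ _ x y w h ↦ ?_⟩
    rw [map_add, map_add, map_mul, map_mul, ← hP x y w h, ← hQ x y w h, map_pow, map_pow,
      aevalAeval_Y]
    ring
  | mul_X p i hp =>
    obtain ⟨k, P, hP⟩ := hp
    fin_cases i
    · refine ⟨k + 1, P * C (1 + C s₀ * X), fun {R} _ _ x y w h ↦ ?_⟩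
      rw [map_mul, map_mul, ← hP x y w h, aevalAeval_C]
      simp
      linear_combination (w ^ k * MvPolynomial.aeval ![x, y] p) * h
    · refine ⟨k + 1, P * C X, fun {R} _ _ x y w h ↦ ?_⟩
      rw [map_mul, map_mul, ← hP x y w h, aevalAeval_X]
      simp
      ring

variable {B} [NeZero n]

/-- The monomials in the chart with `s₀` at infinity are linearly independent. -/
theorem eq_zero_of_chart {s₀ : ℂ} {P : ℂ[X][X]} (hP : P.natDegree < n)
    (h : aevalAeval (B.t - algebraMap ℂ _ s₀)⁻¹ (B.z * (B.t - algebraMap ℂ _ s₀)⁻¹) P = 0) :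
    P = 0 := by
  have hτ : Transcendental ℂ (RatFunc.X - algebraMap ℂ (RatFunc ℂ) s₀)⁻¹ := by
    intro h
    have h1 : IsAlgebraic ℂ (RatFunc.X - algebraMap ℂ (RatFunc ℂ) s₀) := by
      rw [← inv_inv (RatFunc.X - algebraMap ℂ (RatFunc ℂ) s₀)]
      exact h.inv
    have h2 := h1.add (isAlgebraic_algebraMap s₀)
    rw [sub_add_cancel] at h2
    exact RatFunc.transcendental_X h2
  set τ : RatFunc ℂ := (RatFunc.X - algebraMap ℂ (RatFunc ℂ) s₀)⁻¹ with hτdef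
  have hτ0 : τ ≠ 0 := fun h0 ↦ hτ (h0 ▸ isAlgebraic_zero)
  have hτt : algebraMap (RatFunc ℂ) B.FunField τ = (B.t - algebraMap ℂ _ s₀)⁻¹ := by
    rw [hτdef, map_inv₀, map_sub, ← IsScalarTower.algebraMap_apply, t]
  rw [← hτt] at h
  have e : ∑ k : Fin n, algebraMap (RatFunc ℂ) B.FunField (aeval τ (P.coeff k) * τ ^ (k : ℕ)) *
      B.z ^ (k : ℕ) = ∑ k : Fin n, algebraMap (RatFunc ℂ) B.FunField 0 * B.z ^ (k : ℕ) := by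
    simp only [map_zero, zero_mul, Finset.sum_const_zero]
    rw [← h]
    conv_rhs => rw [P.as_sum_range_C_mul_X_pow' hP]
    rw [map_sum, Finset.sum_range]
    refine Finset.sum_congr rfl fun k _ ↦ ?_
    rw [map_mul (aevalAeval _ _), map_pow (aevalAeval _ _), aevalAeval_C, aevalAeval_Y, map_mul,
      map_pow, aeval_algebraMap_apply]
    ring
  have e' := repr_unique _ e
  ext1 k
  rw [coeff_zero]
  by_cases hk : k < n
  · have := congr_fun e' ⟨k, hk⟩
    exact transcendental_iff.1 hτ _ ((mul_eq_zero.1 this).resolve_right (pow_ne_zero _ hτ0))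
  · exact coeff_eq_zero_of_natDegree_lt (by omega)

variable (B)

/-- The homomorphism from the ring of polynomials in the affine coordinates. -/
noncomputable def evalHom : MvPolynomial (Fin 2) ℂ →ₐ[ℂ] B.FunField :=
  MvPolynomial.aeval ![B.t / B.z, 1 / B.z]

theorem prod_eq_one : algebraMap ℂ B.FunField B.lead *
    ∏ s ∈ B.roots, (B.t / B.z - algebraMap ℂ B.FunField s * (1 / B.z)) = 1 := by
  have h := B.z_pow
  have hz := B.z_ne_zero
  rw [poly, map_mul, aeval_C, map_prod] at h
  simp only [map_sub, aeval_X, aeval_C] at h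
  have : ∀ s ∈ B.roots, B.t / B.z - algebraMap ℂ B.FunField s * (1 / B.z) =
      (B.t - algebraMap ℂ B.FunField s) * B.z⁻¹ := fun s _ ↦ by ring
  rw [Finset.prod_congr rfl this, Finset.prod_mul_distrib, Finset.prod_const, B.card_roots,
    ← mul_assoc, ← h, inv_pow, mul_inv_cancel₀ (pow_ne_zero _ hz)]

theorem t_sub_ne_zero (s : ℂ) : B.t - algebraMap ℂ B.FunField s ≠ 0 := by
  have := B.aeval_t_ne_zero (X_sub_C_ne_zero s)
  simpa using this

theorem ker_evalHom : RingHom.ker B.evalHom = Ideal.span {B.affine} := by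
  apply le_antisymm
  · intro Q hQ
    rw [RingHom.mem_ker] at hQ
    obtain ⟨s₀, hs₀⟩ := B.exists_root
    obtain ⟨k, P, hP⟩ := exists_aevalAeval_eq s₀ Q
    have hmonic : (X ^ n - C (B.chart s₀) : ℂ[X][X]).Monic := monic_X_pow_sub_C _ (NeZero.ne n)
    have hdeg : (X ^ n - C (B.chart s₀) : ℂ[X][X]).natDegree = n := natDegree_X_pow_sub_C
    have hsplit := modByMonic_add_div P (X ^ n - C (B.chart s₀))
    have key : ∀ {R : Type} [CommRing R] [Algebra ℂ R] (x y : R),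
        algebraMap ℂ R B.lead * ∏ s ∈ B.roots, (x - algebraMap ℂ R s * y) = 1 →
        ∃ w : R, (x - algebraMap ℂ R s₀ * y) * w = 1 ∧ w ^ k * MvPolynomial.aeval ![x, y] Q =
          aevalAeval (y * w) w (P %ₘ (X ^ n - C (B.chart s₀))) := by
      intro R _ _ x y h
      obtain ⟨w, h1, h2⟩ := B.exists_mul_eq_one hs₀ h
      refine ⟨w, h1, ?_⟩
      rw [hP x y w h1]
      conv_lhs => rw [← hsplit]
      rw [map_add, map_mul, map_sub, map_pow, aevalAeval_Y, aevalAeval_C, h2, sub_self, zero_mul,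
        add_zero]
    have hR : P %ₘ (X ^ n - C (B.chart s₀)) = 0 := by
      obtain ⟨w, h1, h2⟩ := key _ _ B.prod_eq_one
      have hw : w = B.z * (B.t - algebraMap ℂ _ s₀)⁻¹ := by
        have hz := B.z_ne_zero
        have ht := B.t_sub_ne_zero s₀
        rw [← div_eq_mul_inv, eq_div_iff ht]
        field_simp at h1
        linear_combination h1
      have hyw : 1 / B.z * w = (B.t - algebraMap ℂ _ s₀)⁻¹ := by
        rw [hw, ← mul_assoc, one_div, inv_mul_cancel₀ B.z_ne_zero, one_mul]
      refine eq_zero_of_chart (B := B) (s₀ := s₀) ?_ ?_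
      · conv_rhs => rw [← hdeg]
        refine natDegree_modByMonic_lt _ hmonic fun h ↦ ?_
        rw [h, natDegree_one] at hdeg
        exact NeZero.ne n hdeg.symm
      · change MvPolynomial.aeval _ Q = 0 at hQ
        rw [hyw, hQ, mul_zero, hw] at h2
        exact h2.symm
    let I := Ideal.span {B.affine}
    let q : MvPolynomial (Fin 2) ℂ →ₐ[ℂ] MvPolynomial (Fin 2) ℂ ⧸ I := Ideal.Quotient.mkₐ ℂ I
    have hq : q = MvPolynomial.aeval ![q (MvPolynomial.X 0), q (MvPolynomial.X 1)] := by
      ext i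
      fin_cases i <;> simp
    have hone : algebraMap ℂ _ B.lead * ∏ s ∈ B.roots,
        (q (MvPolynomial.X 0) - algebraMap ℂ _ s * q (MvPolynomial.X 1)) = 1 := by
      have h0 : q B.affine = 0 := Ideal.Quotient.eq_zero_iff_mem.2 (Ideal.mem_span_singleton_self _)
      rw [affine, map_sub, map_one, sub_eq_zero, map_mul, map_prod] at h0
      rw [← h0, ← MvPolynomial.algebraMap_eq, AlgHom.commutes]
      rfl
    obtain ⟨w, h1, h2⟩ := key _ _ hone
    rw [hR, map_zero, ← hq] at h2
    have hw : IsUnit w := .of_mul_eq_one_right _ h1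
    have h3 : q Q = 0 := ((hw.pow k).mul_right_eq_zero).1 h2
    exact Ideal.Quotient.eq_zero_iff_mem.1 h3
  · rw [Ideal.span_singleton_le_iff_mem, RingHom.mem_ker, affine, map_sub, map_one, sub_eq_zero,
      ← B.prod_eq_one, map_mul, map_prod, ← MvPolynomial.algebraMap_eq, AlgHom.commutes]
    congr 1
    refine Finset.prod_congr rfl fun s _ ↦ ?_
    rw [map_sub, map_mul, AlgHom.commutes]
    simp [evalHom]

/-- The function field of the plane curve `B(x, y) = 1` is `ℂ(t, z)`. -/
theorem nonempty_algEquiv :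
    Nonempty (FractionRing (MvPolynomial (Fin 2) ℂ ⧸ Ideal.span {B.affine}) ≃ₐ[ℂ] B.FunField) := by
  rw [← B.ker_evalHom]
  have hprime : (RingHom.ker B.evalHom).IsPrime := RingHom.ker_isPrime _
  have hinj := Ideal.kerLiftAlg_injective B.evalHom
  let F := FractionRing (MvPolynomial (Fin 2) ℂ ⧸ RingHom.ker B.evalHom)
  let φ : F →ₐ[ℂ] B.FunField := IsFractionRing.liftAlgHom hinj
  have hφ : ∀ Q, φ (algebraMap _ F (Ideal.Quotient.mk _ Q)) = B.evalHom Q := fun Q ↦ by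
    simp only [φ, IsFractionRing.liftAlgHom_apply]
    rw [IsFractionRing.lift_algebraMap]
    exact Ideal.kerLiftAlg_mk ..
  refine ⟨AlgEquiv.ofBijective φ ⟨φ.toRingHom.injective, fun x ↦ ?_⟩⟩
  have hz : B.z⁻¹ ∈ φ.fieldRange := ⟨_, (hφ (MvPolynomial.X 1)).trans (by simp [evalHom])⟩
  have htz : B.t / B.z ∈ φ.fieldRange := ⟨_, (hφ (MvPolynomial.X 0)).trans (by simp [evalHom])⟩
  have hz' : B.z ∈ φ.fieldRange := by
    rw [← inv_inv B.z]
    exact inv_mem hz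
  have ht : B.t ∈ φ.fieldRange := by
    rw [← div_mul_cancel₀ B.t B.z_ne_zero]
    exact mul_mem htz hz'
  exact B.mem_of_t_mem_of_z_mem φ.fieldRange ht hz' x

end SplitForm

end Polynomial

namespace Polynomial

namespace SplitForm

variable {n : ℕ} (B : SplitForm n)

/-- The values of the binary form. -/
noncomputable def form {R : Type*} [CommRing R] [Algebra ℂ R] (x y : R) : R :=
  algebraMap ℂ R B.lead * ∏ s ∈ B.roots, (x - algebraMap ℂ R s * y)

theorem map_form {R S : Type*} [CommRing R] [Algebra ℂ R] [CommRing S] [Algebra ℂ S]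
    (f : R →ₐ[ℂ] S) (x y : R) : f (B.form x y) = B.form (f x) (f y) := by
  simp [form]

theorem form_mul_mul {R : Type*} [CommRing R] [Algebra ℂ R] (c x y : R) :
    B.form (c * x) (c * y) = c ^ n * B.form x y := by
  have : ∀ s ∈ B.roots, c * x - algebraMap ℂ R s * (c * y) = c * (x - algebraMap ℂ R s * y) :=
    fun s _ ↦ by ring
  rw [form, Finset.prod_congr rfl this, Finset.prod_mul_distrib, Finset.prod_const, B.card_roots,
    form]
  ring

theorem form_one_right {R : Type*} [CommRing R] [Algebra ℂ R] (x : R) :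
    B.form x 1 = aeval x B.poly := by
  simp [form, poly, map_prod]

theorem form_one_zero : B.form (1 : ℂ) 0 = B.lead := by
  simp [form]

theorem form_eq_zero_iff {x y : ℂ} (h : x ≠ 0 ∨ y ≠ 0) :
    B.form x y = 0 ↔ y ≠ 0 ∧ x / y ∈ B.roots := by
  rw [form, mul_eq_zero, Finset.prod_eq_zero_iff]
  constructor
  · rintro (h0 | ⟨s, hs, h0⟩)
    · exact absurd h0 (by simpa using B.lead_ne_zero)
    · have hx : x = s * y := sub_eq_zero.1 h0
      have hy : y ≠ 0 := by
        rintro rfl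
        rw [mul_zero] at hx
        simp [hx] at h
      refine ⟨hy, ?_⟩
      rwa [hx, mul_div_cancel_right₀ _ hy]
  · rintro ⟨hy, hs⟩
    refine .inr ⟨_, hs, ?_⟩
    change x - x / y * y = 0
    rw [div_mul_cancel₀ _ hy, sub_self]

variable [NeZero n]

theorem form_zero_zero : B.form (0 : ℂ) 0 = 0 := by
  simpa [NeZero.ne n] using B.form_mul_mul (0 : ℂ) 0 0

theorem eq_zero_of_aevalAeval {P : ℂ[X][X]} (hP : P.natDegree < n)
    (h : aevalAeval B.t B.z P = 0) : P = 0 := by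
  have e : ∑ k : Fin n, aeval B.t (P.coeff k) * B.z ^ (k : ℕ) =
      ∑ k : Fin n, aeval B.t (0 : ℂ[X]) * B.z ^ (k : ℕ) := by
    simp only [map_zero, zero_mul, Finset.sum_const_zero]
    rw [← h]
    conv_rhs => rw [P.as_sum_range_C_mul_X_pow' hP]
    rw [map_sum, Finset.sum_range]
    refine Finset.sum_congr rfl fun k _ ↦ ?_
    rw [map_mul (aevalAeval _ _), map_pow (aevalAeval _ _), aevalAeval_C, aevalAeval_Y]
  have e' := poly_repr_unique e
  ext1 k
  rw [coeff_zero]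
  by_cases hk : k < n
  · exact congr_fun e' ⟨k, hk⟩
  · exact coeff_eq_zero_of_natDegree_lt (by omega)

theorem eq_mul_kummerInt {P : ℂ[X][X]} (hP : P.natDegree ≤ n)
    (h : aevalAeval B.t B.z P = 0) : P = C (P.coeff n) * B.kummerInt := by
  have hk : aevalAeval B.t B.z B.kummerInt = 0 := by
    rw [kummerInt, map_sub, map_pow, aevalAeval_C, aevalAeval_Y, B.z_pow, sub_self]
  have hd : B.kummerInt.natDegree = n := natDegree_X_pow_sub_C
  have hc : B.kummerInt.coeff n = 1 :=
    (congrArg B.kummerInt.coeff hd).symm.trans B.monic_kummerInt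
  rw [← sub_eq_zero]
  refine B.eq_zero_of_aevalAeval ?_ (by rw [map_sub, h, map_mul, hk, mul_zero, sub_zero])
  refine lt_of_le_of_ne ?_ fun he ↦ ?_
  · refine (natDegree_sub_le_of_le hP (natDegree_C_mul_le _ _)).trans ?_
    rw [hd, max_self]
  · have h0 : (P - C (P.coeff n) * B.kummerInt).coeff n = 0 := by
      rw [coeff_sub, coeff_C_mul, hc, mul_one, sub_self]
    conv at h0 => lhs; arg 2; rw [← he]
    rw [coeff_natDegree, leadingCoeff_eq_zero] at h0
    rw [h0, natDegree_zero] at he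
    exact NeZero.ne n he.symm

/-- A projective transformation between function fields transforms the forms into each other. -/
theorem exists_form_identity {B' : SplitForm n} {M : Matrix (Fin 3) (Fin 3) ℂ} {w : B.FunField}
    (hw : w ≠ 0) {x y : B.FunField} (hxy : y ^ n = aeval x B'.poly)
    (hM : ∀ i, ![x, 1, y] i = w * (algebraMap ℂ B.FunField (M i 0) * B.t +
        algebraMap ℂ B.FunField (M i 1) + algebraMap ℂ B.FunField (M i 2) * B.z)) :
    ∃ β : ℂ, ∀ p q s : ℂ, B'.form (M 0 0 * p + M 0 1 * q + M 0 2 * s)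
        (M 1 0 * p + M 1 1 * q + M 1 2 * s) - (M 2 0 * p + M 2 1 * q + M 2 2 * s) ^ n =
      β * (s ^ n - B.form p q) := by
  let Λ : Fin 3 → ℂ[X][X] := fun i ↦ C (C (M i 0) * X + C (M i 1)) + C (C (M i 2)) * X
  let P : ℂ[X][X] := B'.form (Λ 0) (Λ 1) - Λ 2 ^ n
  have hΛ : ∀ {R : Type} [CommRing R] [Algebra ℂ R] (T Z : R) (i), aevalAeval T Z (Λ i) =
      algebraMap ℂ R (M i 0) * T + algebraMap ℂ R (M i 1) + algebraMap ℂ R (M i 2) * Z := by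
    intro R _ _ T Z i
    rw [map_add, map_mul (aevalAeval _ _), aevalAeval_C, aevalAeval_C, aevalAeval_Y]
    simp
  have hlin : ∀ c : ℂ, Λ 0 - algebraMap ℂ ℂ[X][X] c * Λ 1 =
      C (C (M 0 2 - c * M 1 2)) * X +
        C (C (M 0 0 - c * M 1 0) * X + C (M 0 1 - c * M 1 1)) := by
    intro c
    change _ - C (C c) * _ = _
    simp only [Λ, map_add, map_sub, map_mul]
    ring
  have hdeg2 : (Λ 2).natDegree ≤ 1 := by
    simp only [Λ]
    rw [add_comm]
    exact natDegree_linear_le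
  have hdeg : ∀ c : ℂ, (Λ 0 - algebraMap ℂ ℂ[X][X] c * Λ 1).natDegree ≤ 1 := fun c ↦ by
    rw [hlin]
    exact natDegree_linear_le
  have hform : (B'.form (Λ 0) (Λ 1)).natDegree ≤ n := by
    change (C (C B'.lead) * _).natDegree ≤ n
    refine (natDegree_C_mul_le _ _).trans ((natDegree_prod_le _ _).trans ?_)
    refine (Finset.sum_le_card_nsmul _ _ 1 fun s _ ↦ hdeg s).trans ?_
    rw [B'.card_roots, smul_eq_mul, mul_one]
  have hpow : (Λ 2 ^ n).natDegree ≤ n := by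
    simpa using natDegree_pow_le_of_le n hdeg2
  have hcoeff : ∃ β : ℂ, P.coeff n = C β := by
    refine ⟨B'.lead * ∏ s ∈ B'.roots, (M 0 2 - s * M 1 2) - M 2 2 ^ n, ?_⟩
    rw [coeff_sub]
    have e1 : (Λ 2 ^ n).coeff n = C (M 2 2 ^ n) := by
      have := coeff_pow_of_natDegree_le (m := n) hdeg2
      rw [mul_one] at this
      rw [this]
      simp [Λ]
    have e2 : (B'.form (Λ 0) (Λ 1)).coeff n =
        C (B'.lead * ∏ s ∈ B'.roots, (M 0 2 - s * M 1 2)) := by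
      change (C (C B'.lead) * _ : ℂ[X][X]).coeff n = _
      have := coeff_prod_of_natDegree_le B'.roots
        (fun c ↦ Λ 0 - algebraMap ℂ ℂ[X][X] c * Λ 1) 1 fun c _ ↦ hdeg c
      rw [B'.card_roots, mul_one] at this
      rw [coeff_C_mul, this, map_mul, map_prod]
      congr 1
      refine Finset.prod_congr rfl fun c _ ↦ ?_
      rw [hlin]
      simp
    rw [e1, e2, map_sub]
  obtain ⟨β, hβ⟩ := hcoeff
  have hP : aevalAeval B.t B.z P = 0 := by
    have h0 := hM 0
    have h1 := hM 1
    have h2 := hM 2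
    simp only [Matrix.cons_val_zero, Matrix.cons_val_one, Matrix.cons_val] at h0 h1 h2
    rw [map_sub, map_pow, map_form, hΛ, hΛ, hΛ]
    have hwn := pow_ne_zero n hw
    apply mul_left_cancel₀ hwn
    rw [mul_zero, mul_sub, ← form_mul_mul, ← mul_pow, ← h0, ← h1, ← h2, form_one_right, hxy,
      sub_self]
  have hPeq := B.eq_mul_kummerInt (natDegree_sub_le_of_le hform hpow |>.trans (max_self n).le) hP
  rw [hβ] at hPeq
  have hval : ∀ T Z : ℂ, B'.form (M 0 0 * T + M 0 1 + M 0 2 * Z) (M 1 0 * T + M 1 1 + M 1 2 * Z) -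
      (M 2 0 * T + M 2 1 + M 2 2 * Z) ^ n = β * (Z ^ n - B.form T 1) := by
    intro T Z
    have := congr(aevalAeval T Z $hPeq)
    rw [map_sub, map_pow, map_form, hΛ, hΛ, hΛ, map_mul, aevalAeval_C, kummerInt, map_sub, map_pow,
      aevalAeval_C, aevalAeval_Y, ← form_one_right, aeval_C] at this
    exact this
  refine ⟨β, fun p q s ↦ ?_⟩
  have hcont : ∀ (D : SplitForm n) (f g : ℂ → ℂ), Continuous f → Continuous g →
      Continuous fun q ↦ D.form (f q) (g q) := fun D f g hf hg ↦ by
    unfold form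
    fun_prop
  refine congr_fun (Continuous.ext_on (dense_compl_singleton (0 : ℂ))
    (f := fun q ↦ B'.form (M 0 0 * p + M 0 1 * q + M 0 2 * s)
        (M 1 0 * p + M 1 1 * q + M 1 2 * s) - (M 2 0 * p + M 2 1 * q + M 2 2 * s) ^ n)
    (g := fun q ↦ β * (s ^ n - B.form p q)) ?_ ?_ fun q hq ↦ ?_) q
  · exact (hcont _ _ _ (by fun_prop) (by fun_prop)).sub (by fun_prop)
  · exact continuous_const.mul (continuous_const.sub (hcont _ _ _ (by fun_prop) (by fun_prop)))
  · have hq' : q ≠ 0 := hq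
    have hi : ∀ i, M i 0 * p + M i 1 * q + M i 2 * s =
        q * (M i 0 * (p / q) + M i 1 + M i 2 * (s / q)) := fun i ↦ by field_simp
    have hpq : B.form p q = q ^ n * B.form (p / q) 1 := by
      rw [← form_mul_mul, mul_div_cancel₀ _ hq', mul_one]
    have hs : s ^ n = q ^ n * (s / q) ^ n := by rw [← mul_pow, mul_div_cancel₀ _ hq']
    change B'.form _ _ - _ = β * (s ^ n - B.form p q)
    rw [hi, hi, hi, form_mul_mul, mul_pow, ← mul_sub, hval, hpq, hs]
    ring

end SplitForm

end Polynomial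

namespace Polynomial

namespace SplitForm

variable {n : ℕ} {B B' : SplitForm n} [NeZero n]

omit [NeZero n] in
/-- If two forms agree up to a constant after a linear change of variables, then the roots
correspond to each other projectively. -/
theorem root_map_of_linear {a b c d β : ℂ} (hD : a * d - b * c ≠ 0)
    (h : ∀ p q : ℂ, B'.form p q = β * B.form (a * p + b * q) (c * p + d * q)) :
    ∃ (σ γ : ℂ → ℂ) (D : ℂ), D ≠ 0 ∧ (∀ r ∈ B'.roots, γ r ≠ 0 ∧ σ r ∈ B.roots) ∧
      ∀ r ∈ B'.roots, ∀ r' ∈ B'.roots, D * (r - r') = γ r * γ r' * (σ r - σ r') := by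
  have hβ : β ≠ 0 := by
    rintro rfl
    have := h 1 0
    rw [form_one_zero, zero_mul] at this
    exact B'.lead_ne_zero this
  have key : ∀ r ∈ B'.roots, c * r + d ≠ 0 ∧ (a * r + b) / (c * r + d) ∈ B.roots := by
    intro r hr
    have h1 : B'.form r 1 = 0 :=
      (B'.form_eq_zero_iff (.inr one_ne_zero)).2 ⟨one_ne_zero, by rwa [div_one]⟩
    rw [h, mul_one, mul_one, mul_eq_zero, or_iff_right hβ] at h1
    refine (B.form_eq_zero_iff ?_).1 h1
    by_contra! h0
    apply hD
    linear_combination (-c) * h0.1 + a * h0.2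
  refine ⟨fun r ↦ (a * r + b) / (c * r + d), fun r ↦ c * r + d, a * d - b * c, hD, key, ?_⟩
  intro r hr r' hr'
  have h1 := (key r hr).1
  have h2 := (key r' hr').1
  field_simp
  ring

/-- If a form is the sum of two `n`-th powers of linear forms, its roots correspond
projectively to `n`-th roots of unity. -/
theorem root_map_of_fermat (hn : 2 ≤ n) {a b c d α β : ℂ} (hD : a * d - b * c ≠ 0)
    (h : ∀ p q : ℂ, B'.form p q = α * (a * p + b * q) ^ n + β * (c * p + d * q) ^ n) :
    ∃ (σ γ : ℂ → ℂ) (D : ℂ), D ≠ 0 ∧ (∀ r ∈ B'.roots, γ r ≠ 0 ∧ σ r ^ n = 1) ∧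
      ∀ r ∈ B'.roots, ∀ r' ∈ B'.roots, D * (r - r') = γ r * γ r' * (σ r - σ r') := by
  have hroot : ∀ r ∈ B'.roots, α * (a * r + b) ^ n + β * (c * r + d) ^ n = 0 := by
    intro r hr
    have h1 : B'.form r 1 = 0 :=
      (B'.form_eq_zero_iff (.inr one_ne_zero)).2 ⟨one_ne_zero, by rwa [div_one]⟩
    rwa [h, mul_one, mul_one] at h1
  obtain ⟨r₁, hr₁, r₂, hr₂, hr⟩ : ∃ r₁ ∈ B'.roots, ∃ r₂ ∈ B'.roots, r₁ ≠ r₂ :=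
    Finset.one_lt_card.1 (by rw [B'.card_roots]; omega)
  have hn0 := NeZero.ne n
  have hnonzero : α ≠ 0 ∨ β ≠ 0 := by
    by_contra! h0
    have := h 1 0
    rw [form_one_zero, h0.1, h0.2] at this
    exact B'.lead_ne_zero (by simpa using this)
  have hβ : β ≠ 0 := by
    intro h0
    have hα := hnonzero.resolve_right (not_not.2 h0)
    have e : ∀ r ∈ B'.roots, a * r + b = 0 := fun r hr ↦ by
      have := hroot r hr
      rw [h0, zero_mul, add_zero, mul_eq_zero, or_iff_right hα] at this
      exact pow_eq_zero_iff hn0 |>.1 this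
    have ha : a = 0 := by
      have : a * (r₁ - r₂) = 0 := by linear_combination e r₁ hr₁ - e r₂ hr₂
      exact (mul_eq_zero.1 this).resolve_right (sub_ne_zero.2 hr)
    have hb : b = 0 := by simpa [ha] using e r₁ hr₁
    simp [ha, hb] at hD
  have hα : α ≠ 0 := by
    intro h0
    have e : ∀ r ∈ B'.roots, c * r + d = 0 := fun r hr ↦ by
      have := hroot r hr
      rw [h0, zero_mul, zero_add, mul_eq_zero, or_iff_right hβ] at this
      exact pow_eq_zero_iff hn0 |>.1 this
    have hc : c = 0 := by
      have : c * (r₁ - r₂) = 0 := by linear_combination e r₁ hr₁ - e r₂ hr₂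
      exact (mul_eq_zero.1 this).resolve_right (sub_ne_zero.2 hr)
    have hd : d = 0 := by simpa [hc] using e r₁ hr₁
    simp [hc, hd] at hD
  obtain ⟨κ, hκ⟩ := IsAlgClosed.exists_pow_nat_eq (-β / α) (NeZero.pos n)
  have hκ0 : κ ≠ 0 := by
    rintro rfl
    rw [zero_pow hn0, eq_comm, div_eq_zero_iff, neg_eq_zero] at hκ
    exact hκ.elim hβ hα
  have hne : ∀ r ∈ B'.roots, c * r + d ≠ 0 := by
    intro r hr h0
    have := hroot r hr
    rw [h0, zero_pow hn0, mul_zero, add_zero, mul_eq_zero, or_iff_right hα,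
      pow_eq_zero_iff hn0] at this
    apply hD
    linear_combination (-c) * this + a * h0
  refine ⟨fun r ↦ (a * r + b) / (κ * (c * r + d)), fun r ↦ c * r + d, (a * d - b * c) / κ,
    div_ne_zero hD hκ0, fun r hr ↦ ⟨hne r hr, ?_⟩, ?_⟩
  · have h1 := hne r hr
    have h2 := hroot r hr
    have h3 : -β / α * (c * r + d) ^ n ≠ 0 :=
      mul_ne_zero (hκ ▸ pow_ne_zero n hκ0) (pow_ne_zero _ h1)
    rw [div_pow, mul_pow, hκ, div_eq_one_iff_eq h3, div_mul_eq_mul_div, eq_div_iff hα]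
    linear_combination h2
  · intro r hr r' hr'
    have h1 := hne r hr
    have h2 := hne r' hr'
    field_simp
    ring

theorem root_map_of_form_identity (hn : 2 ≤ n) (hodd : Odd n) {M : Matrix (Fin 3) (Fin 3) ℂ}
    (hM : M.det ≠ 0) {β : ℂ}
    (h : ∀ p q s : ℂ, B'.form (M 0 0 * p + M 0 1 * q + M 0 2 * s)
        (M 1 0 * p + M 1 1 * q + M 1 2 * s) - (M 2 0 * p + M 2 1 * q + M 2 2 * s) ^ n =
      β * (s ^ n - B.form p q)) :
    ∃ (σ γ : ℂ → ℂ) (D : ℂ), D ≠ 0 ∧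
      (∀ r ∈ B'.roots, γ r ≠ 0 ∧ (σ r ∈ B.roots ∨ σ r ^ n = 1)) ∧
      ∀ r ∈ B'.roots, ∀ r' ∈ B'.roots, D * (r - r') = γ r * γ r' * (σ r - σ r') := by
  obtain ⟨N, hMN, hNM⟩ : ∃ N, M * N = 1 ∧ N * M = 1 :=
    ⟨M⁻¹, Matrix.mul_nonsing_inv M hM.isUnit, Matrix.nonsing_inv_mul M hM.isUnit⟩
  have mn : ∀ i j, M i 0 * N 0 j + M i 1 * N 1 j + M i 2 * N 2 j = if i = j then 1 else 0 := by
    intro i j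
    have := congr_fun (congr_fun hMN i) j
    rwa [Matrix.mul_apply, Fin.sum_univ_three, Matrix.one_apply] at this
  have nm : ∀ i j, N i 0 * M 0 j + N i 1 * M 1 j + N i 2 * M 2 j = if i = j then 1 else 0 := by
    intro i j
    have := congr_fun (congr_fun hNM i) j
    rwa [Matrix.mul_apply, Fin.sum_univ_three, Matrix.one_apply] at this
  have J : ∀ p q s : ℂ, B'.form p q - s ^ n = β * ((N 2 0 * p + N 2 1 * q + N 2 2 * s) ^ n -
      B.form (N 0 0 * p + N 0 1 * q + N 0 2 * s) (N 1 0 * p + N 1 1 * q + N 1 2 * s)) := by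
    intro p q s
    rw [← h]
    have e : ∀ i, M i 0 * (N 0 0 * p + N 0 1 * q + N 0 2 * s) +
        M i 1 * (N 1 0 * p + N 1 1 * q + N 1 2 * s) + M i 2 * (N 2 0 * p + N 2 1 * q + N 2 2 * s) =
        (if i = 0 then 1 else 0) * p + (if i = 1 then 1 else 0) * q +
          (if i = 2 then 1 else 0) * s := fun i ↦ by
      rw [← mn, ← mn, ← mn]
      ring
    rw [e, e, e]
    simp
  have hβ : β ≠ 0 := by
    rintro rfl
    have := J 0 0 1
    rw [form_zero_zero] at this
    simp at this
  have star : ∀ p q s x : ℂ, B'.form (p + x * M 0 2) (q + x * M 1 2) - B'.form p q -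
      ((s + x * M 2 2) ^ n - s ^ n) =
      β * ((N 2 0 * p + N 2 1 * q + N 2 2 * s + x) ^ n -
        (N 2 0 * p + N 2 1 * q + N 2 2 * s) ^ n) := by
    intro p q s x
    have e1 := J (p + x * M 0 2) (q + x * M 1 2) (s + x * M 2 2)
    have f0 : N 0 0 * (p + x * M 0 2) + N 0 1 * (q + x * M 1 2) + N 0 2 * (s + x * M 2 2) =
        N 0 0 * p + N 0 1 * q + N 0 2 * s := by
      have := nm 0 2
      rw [if_neg (by decide)] at this
      linear_combination x * this
    have f1 : N 1 0 * (p + x * M 0 2) + N 1 1 * (q + x * M 1 2) + N 1 2 * (s + x * M 2 2) =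
        N 1 0 * p + N 1 1 * q + N 1 2 * s := by
      have := nm 1 2
      rw [if_neg (by decide)] at this
      linear_combination x * this
    have f2 : N 2 0 * (p + x * M 0 2) + N 2 1 * (q + x * M 1 2) + N 2 2 * (s + x * M 2 2) =
        N 2 0 * p + N 2 1 * q + N 2 2 * s + x := by
      have := nm 2 2
      rw [if_pos rfl] at this
      linear_combination x * this
    rw [f0, f1, f2] at e1
    linear_combination e1 - J p q s
  have hn0 := NeZero.ne n
  have h2n : (2 : ℂ) ^ n ≠ 2 := by
    intro h0
    have : (2 : ℕ) ^ n = 2 ^ 1 := by exact_mod_cast h0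
    have := Nat.pow_right_injective le_rfl this
    omega
  have hneg : (-1 : ℂ) ^ n = -1 := hodd.neg_one_pow
  by_cases h3 : N 2 2 = 0
  · have hm3 : M 2 2 = 0 := by
      have e0 := star 0 0 0 1
      have e1 := star 0 0 (M 2 2) 1
      rw [h3] at e0 e1
      have : (M 2 2) ^ n * (2 ^ n - 2) = 0 := by
        have e2 : (M 2 2 + 1 * M 2 2) ^ n = 2 ^ n * (M 2 2) ^ n := by
          rw [← mul_pow]
          congr 1
          ring
        rw [e2] at e1
        simp only [zero_add, one_mul, mul_zero, add_zero, zero_mul, zero_pow hn0] at e0 e1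
        linear_combination e0 - e1
      exact pow_eq_zero_iff hn0 |>.1 ((mul_eq_zero.1 this).resolve_right (sub_ne_zero.2 h2n))
    have hμm : N 2 0 * M 0 2 + N 2 1 * M 1 2 = 1 := by
      have := nm 2 2
      rwa [if_pos rfl, hm3, mul_zero, add_zero] at this
    obtain ⟨σ, γ, D, hD, h1, h2⟩ := root_map_of_fermat (B' := B') hn (a := - M 1 2) (b := M 0 2)
      (c := N 2 0) (d := N 2 1) (α := B'.form (- N 2 1) (N 2 0)) (β := β)
      (by
        rw [show - M 1 2 * N 2 1 - M 0 2 * N 2 0 = -1 by linear_combination - hμm]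
        exact neg_ne_zero.2 one_ne_zero) (by
        intro p q
        have := star ((- M 1 2 * p + M 0 2 * q) * (- N 2 1)) ((- M 1 2 * p + M 0 2 * q) * N 2 0) 0
          (N 2 0 * p + N 2 1 * q)
        rw [form_mul_mul, hm3, show (- M 1 2 * p + M 0 2 * q) * (- N 2 1) +
          (N 2 0 * p + N 2 1 * q) * M 0 2 = p by linear_combination p * hμm,
          show (- M 1 2 * p + M 0 2 * q) * N 2 0 +
          (N 2 0 * p + N 2 1 * q) * M 1 2 = q by linear_combination q * hμm,
          show N 2 0 * ((- M 1 2 * p + M 0 2 * q) * (- N 2 1)) +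
            N 2 1 * ((- M 1 2 * p + M 0 2 * q) * N 2 0) = 0 by ring] at this
        simp only [zero_add, mul_zero, add_zero, zero_pow hn0, sub_zero] at this
        linear_combination this)
    exact ⟨σ, γ, D, hD, fun r hr ↦ ⟨(h1 r hr).1, .inr (h1 r hr).2⟩, h2⟩
  · have hμ : N 2 0 = 0 ∧ N 2 1 = 0 := by
      by_contra h0
      obtain ⟨p, q, hpq⟩ : ∃ p q, N 2 0 * p + N 2 1 * q = 1 := by
        by_cases h00 : N 2 0 = 0
        · have h01 : N 2 1 ≠ 0 := fun h1 ↦ h0 ⟨h00, h1⟩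
          exact ⟨0, (N 2 1)⁻¹, by rw [mul_inv_cancel₀ h01]; ring⟩
        · exact ⟨(N 2 0)⁻¹, 0, by rw [mul_inv_cancel₀ h00]; ring⟩
      have e1 := star p q (-(N 2 2)⁻¹) 1
      have e2 := star p q 0 1
      have e3 := star 0 0 (-(N 2 2)⁻¹) 1
      have e4 := star 0 0 0 1
      have hs : N 2 2 * -(N 2 2)⁻¹ = -1 := by rw [mul_neg, mul_inv_cancel₀ h3]
      rw [hpq] at e1 e2
      rw [hs] at e1 e3
      have e5 : β * (2 ^ n - 2) = 0 := by
        simp only [mul_zero, add_zero, zero_add, neg_add_cancel, add_neg_cancel, zero_pow hn0,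
          one_pow, hneg, one_add_one_eq_two] at e1 e2 e3 e4
        linear_combination e1 + e4 - e2 - e3
      exact (mul_ne_zero hβ (sub_ne_zero.2 h2n)) e5
    have hshift : ∀ p q x : ℂ, B'.form (p + x * M 0 2) (q + x * M 1 2) = B'.form p q +
        x ^ n * B'.form (M 0 2) (M 1 2) := by
      intro p q x
      have e1 := star p q 0 x
      have e2 := star 0 0 0 x
      rw [hμ.1, hμ.2] at e1 e2
      simp only [mul_zero, add_zero, zero_add, zero_mul, zero_pow hn0, form_zero_zero,
        form_mul_mul] at e1 e2
      linear_combination e1 - e2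
    have hFm : B'.form (M 0 2) (M 1 2) = 0 := by
      have e1 := hshift (M 0 2) (M 1 2) 1
      rw [show M 0 2 + 1 * M 0 2 = 2 * M 0 2 by ring, show M 1 2 + 1 * M 1 2 = 2 * M 1 2 by ring,
        form_mul_mul, one_pow] at e1
      have : (2 ^ n - 2) * B'.form (M 0 2) (M 1 2) = 0 := by linear_combination e1
      exact (mul_eq_zero.1 this).resolve_left (sub_ne_zero.2 h2n)
    have hm : M 0 2 = 0 ∧ M 1 2 = 0 := by
      by_contra h0
      have h0' : M 0 2 ≠ 0 ∨ M 1 2 ≠ 0 := by tauto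
      obtain ⟨hy, hs⟩ := (B'.form_eq_zero_iff h0').1 hFm
      obtain ⟨r, hr, hrne⟩ := Finset.exists_mem_ne
        (by rw [B'.card_roots]; omega : 1 < B'.roots.card) (M 0 2 / M 1 2)
      have hne : M 0 2 / M 1 2 - r ≠ 0 := sub_ne_zero.2 hrne.symm
      have e1 := hshift (- r) (-1) (1 / M 1 2)
      rw [hFm, mul_zero, add_zero, show -1 + 1 / M 1 2 * M 1 2 = 0 by field_simp; ring,
        show - r + 1 / M 1 2 * M 0 2 = (M 0 2 / M 1 2 - r) * 1 by ring] at e1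
      have e2 := B'.form_mul_mul (M 0 2 / M 1 2 - r) 1 0
      rw [mul_zero, form_one_zero] at e2
      have e3 : B'.form (-r) (-1) = 0 :=
        (B'.form_eq_zero_iff (.inr (by simp))).2 ⟨by simp, by simpa using hr⟩
      rw [e2, e3] at e1
      exact mul_ne_zero (pow_ne_zero _ hne) B'.lead_ne_zero e1
    have hdetN : N 0 0 * N 1 1 - N 0 1 * N 1 0 ≠ 0 := by
      have := congr(Matrix.det $hNM)
      rw [Matrix.det_mul, Matrix.det_one] at this
      have hN := left_ne_zero_of_mul_eq_one this
      rw [Matrix.det_fin_three, hμ.1, hμ.2] at hN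
      intro h0
      apply hN
      linear_combination N 2 2 * h0
    obtain ⟨σ, γ, D, hD, h1, h2⟩ := root_map_of_linear (B := B) (B' := B') hdetN (β := -β) (by
      intro p q
      have := J p q 0
      rw [hμ.1, hμ.2] at this
      simp only [mul_zero, zero_mul, add_zero, zero_pow hn0] at this
      linear_combination this)
    exact ⟨σ, γ, D, hD, fun r hr ↦ ⟨(h1 r hr).1, .inl (h1 r hr).2⟩, h2⟩

/-- If the function fields are isomorphic, every cross ratio of roots of one form is a
cross ratio of roots of the other, or a cross ratio of roots of unity. -/
theorem exists_crossRatio_eq (hn : 5 ≤ n) (hodd : Odd n) (θ : B'.FunField ≃ₐ[ℂ] B.FunField) :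
    ∃ σ : ℂ → ℂ, Set.InjOn σ B'.roots ∧ (∀ r ∈ B'.roots, σ r ∈ B.roots ∨ σ r ^ n = 1) ∧
      ∀ r₁ ∈ B'.roots, ∀ r₂ ∈ B'.roots, ∀ r₃ ∈ B'.roots, ∀ r₄ ∈ B'.roots,
        (r₁ - r₂) * (r₃ - r₄) * ((σ r₁ - σ r₃) * (σ r₂ - σ r₄)) =
          (r₁ - r₃) * (r₂ - r₄) * ((σ r₁ - σ r₂) * (σ r₃ - σ r₄)) := by
  obtain ⟨r, hr⟩ : ∃ r, r + 3 = n := ⟨n - 3, by omega⟩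
  obtain ⟨W, hx, hy⟩ := exists_planeCoords hr θ
  obtain ⟨M, w, hM, hw, hMw⟩ := W.exists_projective hr (by omega)
  obtain ⟨β, hβ⟩ := B.exists_form_identity (B' := B') (x := W.x) (y := W.y) hw (by
    rw [hx, hy, ← map_pow, B'.z_pow, aeval_algHom_apply θ]) hMw
  obtain ⟨σ, γ, D, hD, h1, h2⟩ := root_map_of_form_identity (by omega) hodd hM hβ
  refine ⟨σ, fun r hr r' hr' h ↦ ?_, fun r hr ↦ (h1 r hr).2, ?_⟩
  · have := h2 r hr r' hr'
    rw [h, sub_self, mul_zero, mul_eq_zero, or_iff_right hD] at this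
    exact sub_eq_zero.1 this
  · intro r₁ m₁ r₂ m₂ r₃ m₃ r₄ m₄
    have g : γ r₁ * γ r₂ * γ r₃ * γ r₄ * D ^ 2 ≠ 0 := by
      have := (h1 r₁ m₁).1
      have := (h1 r₂ m₂).1
      have := (h1 r₃ m₃).1
      have := (h1 r₄ m₄).1
      positivity
    apply mul_left_cancel₀ g
    have e12 := h2 r₁ m₁ r₂ m₂
    have e34 := h2 r₃ m₃ r₄ m₄
    have e13 := h2 r₁ m₁ r₃ m₃
    have e24 := h2 r₂ m₂ r₄ m₄
    calc _ = (D * (r₁ - r₂)) * (D * (r₃ - r₄)) *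
          ((γ r₁ * γ r₃ * (σ r₁ - σ r₃)) * (γ r₂ * γ r₄ * (σ r₂ - σ r₄))) := by ring
      _ = (D * (r₁ - r₃)) * (D * (r₂ - r₄)) *
          ((γ r₁ * γ r₂ * (σ r₁ - σ r₂)) * (γ r₃ * γ r₄ * (σ r₃ - σ r₄))) := by
        rw [e12, e34, e13, e24]
        ring
      _ = _ := by ring

end SplitForm

end Polynomial

namespace Polynomial

namespace SplitForm

variable {n : ℕ} (B : SplitForm n)

/-- The homogeneous equation of the plane curve attached to a form. -/
noncomputable def proj : MvPolynomial (Fin 3) ℂ :=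
  B.form (MvPolynomial.X 0) (MvPolynomial.X 1) - MvPolynomial.X 2 ^ n

theorem isNonsingular_proj (hn : 2 ≤ n) : IsNonsingular B.proj := by
  rintro v hv ⟨h0, h1⟩
  have hn0 : n ≠ 0 := by omega
  have d2 : pderiv 2 (B.form (MvPolynomial.X 0) (MvPolynomial.X 1) : MvPolynomial (Fin 3) ℂ)
      = 0 := by
    rw [form, MvPolynomial.algebraMap_eq, pderiv_C_mul]
    rw [Finset.prod_induction _ (fun p : MvPolynomial (Fin 3) ℂ ↦ pderiv 2 p = 0)
      (fun p q hp hq ↦ by rw [pderiv_mul, hp, hq]; simp) pderiv_one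
      fun s _ ↦ by simp [pderiv_X], mul_zero]
  have hz : v 2 = 0 := by
    have := h1 2
    rw [proj, map_sub, d2, zero_sub, pderiv_pow, pderiv_X_self, map_neg, map_mul, map_mul,
      map_pow, MvPolynomial.eval_X] at this
    have hn' : (n : ℂ) ≠ 0 := by exact_mod_cast hn0
    have : v 2 ^ (n - 1) = 0 := by simpa [hn'] using this
    exact pow_eq_zero_iff (by omega) |>.1 this
  have hF : B.form (v 0) (v 1) = 0 := by
    rw [proj, map_sub, map_pow, MvPolynomial.eval_X, hz, zero_pow hn0, sub_zero,
      ← MvPolynomial.coe_aeval_eq_eval] at h0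
    have := B.map_form (MvPolynomial.aeval v) (MvPolynomial.X 0) (MvPolynomial.X 1)
    rw [MvPolynomial.aeval_X, MvPolynomial.aeval_X] at this
    rw [← this]
    exact h0
  have hxy : v 0 ≠ 0 ∨ v 1 ≠ 0 := by
    by_contra! h
    apply hv
    ext i
    fin_cases i
    exacts [h.1, h.2, hz]
  obtain ⟨hy, hs⟩ := (B.form_eq_zero_iff hxy).1 hF
  have d0 := h1 0
  have e : B.form (MvPolynomial.X 0) (MvPolynomial.X 1) =
      (MvPolynomial.X 0 - MvPolynomial.C (v 0 / v 1) * MvPolynomial.X 1) *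
        (MvPolynomial.C B.lead * ∏ s ∈ B.roots.erase (v 0 / v 1),
          (MvPolynomial.X 0 - MvPolynomial.C s * MvPolynomial.X 1) : MvPolynomial (Fin 3) ℂ) := by
    rw [form, ← Finset.mul_prod_erase _ _ hs, MvPolynomial.algebraMap_eq]
    ring
  rw [proj, map_sub, e, pderiv_mul, pderiv_pow] at d0
  simp [pderiv_X, hy, B.lead_ne_zero, map_prod, Finset.prod_eq_zero_iff] at d0
  obtain ⟨s, ⟨hne, hs'⟩, h⟩ := d0
  apply hne
  rw [eq_div_iff hy]
  linear_combination - h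

variable [NeZero n]

theorem nonempty_algEquiv_of_curvesIsomorphic {B B' : SplitForm n}
    (h : CurvesIsomorphic B.affine B'.affine) : Nonempty (B.FunField ≃ₐ[ℂ] B'.FunField) := by
  obtain ⟨e⟩ := h
  obtain ⟨f⟩ := B.nonempty_algEquiv
  obtain ⟨g⟩ := B'.nonempty_algEquiv
  exact ⟨(f.symm.trans e).trans g⟩

end SplitForm

end Polynomial

/-- The roots of the form `(X³ + aY³) ∏_j (b_j²X² + b_j c_j XY + c_j² Y²)`, where `α³ = a` and
`ω` is a primitive cube root of unity. -/
noncomputable def curveRoot (α ω : ℂ) {m : ℕ} (bc : Fin m → ℤ × ℤ) : Fin 3 ⊕ Fin m × Fin 2 → ℂ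
  | .inl i => - α * ω ^ (i : ℕ)
  | .inr (j, k) => ω ^ (k + 1 : ℕ) * ((bc j).2 / (bc j).1)

/-- The parameters which lead to a form with distinct roots, none of them at infinity. -/
def IsGoodParam (a : ℤ) (x : ℤ × ℤ) : Prop := x.1 ≠ 0 ∧ x.2 ≠ 0 ∧ x.2 ^ 3 + a * x.1 ^ 3 ≠ 0

variable {α ω : ℂ} {a : ℤ} {m : ℕ} {bc : Fin m → ℤ × ℤ}

theorem curveRoot_injective (hα : α ^ 3 = a) (ha : a ≠ 0) (hω : IsPrimitiveRoot ω 3)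
    (hgood : ∀ j, IsGoodParam a (bc j))
    (hbc : ∀ i j, i ≠ j → (bc i).1 * (bc j).2 ≠ (bc i).2 * (bc j).1) :
    Function.Injective (curveRoot α ω bc) := by
  have hα0 : α ≠ 0 := by
    rintro rfl
    rw [zero_pow (by norm_num)] at hα
    exact ha (by exact_mod_cast hα.symm)
  have hω3 : ω ^ 3 = 1 := hω.pow_eq_one
  have cube : ∀ (k : ℕ) (x : ℂ), (ω ^ k * x) ^ 3 = x ^ 3 := fun k x ↦ by
    rw [mul_pow, ← pow_mul, mul_comm k, pow_mul, hω3, one_pow, one_mul]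
  have hne : ∀ (i : Fin 3) (j : Fin m) (k : Fin 2),
      curveRoot α ω bc (.inl i) ≠ curveRoot α ω bc (.inr (j, k)) := by
    intro i j k h
    have h3 := congr($h ^ 3)
    obtain ⟨g1, g2, g3⟩ := hgood j
    have g1' : ((bc j).1 : ℂ) ≠ 0 := by exact_mod_cast g1
    simp only [curveRoot] at h3
    rw [mul_comm (-α), cube, cube, neg_pow, hα] at h3
    field_simp at h3
    apply g3
    have : (((bc j).2 ^ 3 + a * (bc j).1 ^ 3 : ℤ) : ℂ) = 0 := by
      push_cast
      linear_combination - h3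
    exact_mod_cast this
  rintro (i | ⟨j, k⟩) (i' | ⟨j', k'⟩) h
  · simp only [curveRoot] at h
    have := hω.pow_inj i.2 i'.2 (mul_left_cancel₀ (neg_ne_zero.2 hα0) h)
    rw [Fin.ext this]
  · exact (hne _ _ _ h).elim
  · exact (hne _ _ _ h.symm).elim
  · have h3 := congr($h ^ 3)
    obtain ⟨g1, g2, g3⟩ := hgood j
    obtain ⟨g1', g2', g3'⟩ := hgood j'
    have c1 : ((bc j).1 : ℂ) ≠ 0 := by exact_mod_cast g1
    have c1' : ((bc j').1 : ℂ) ≠ 0 := by exact_mod_cast g1'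
    have c2 : ((bc j).2 : ℂ) ≠ 0 := by exact_mod_cast g2
    simp only [curveRoot] at h3 h
    rw [cube, cube] at h3
    field_simp at h3
    have hz : ((bc j).1 * (bc j').2) ^ 3 = ((bc j).2 * (bc j').1) ^ 3 := by
      have : ((((bc j).1 * (bc j').2) ^ 3 : ℤ) : ℂ) = (((bc j).2 * (bc j').1) ^ 3 : ℤ) := by
        push_cast
        linear_combination - h3
      exact_mod_cast this
    have hj : j = j' := by
      by_contra hjj
      exact hbc j j' hjj ((Odd.strictMono_pow (by decide : Odd 3)).injective hz)
    subst hj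
    have := hω.pow_inj (by omega) (by omega) (mul_right_cancel₀ (div_ne_zero c2 c1) h)
    have : k = k' := Fin.ext (by omega)
    rw [this]

/-- The binary form of the curve `C(a, bc)`. -/
noncomputable def curveForm (α ω : ℂ) (bc : Fin m → ℤ × ℤ)
    (hinj : Function.Injective (curveRoot α ω bc)) (h0 : ∀ j, (bc j).1 ≠ 0) {n : ℕ}
    (hn : 3 + m * 2 = n) : Polynomial.SplitForm n where
  roots := Finset.univ.map ⟨curveRoot α ω bc, hinj⟩
  card_roots := by simp [← hn]
  lead := ∏ j, ((bc j).1 : ℂ) ^ 2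
  lead_ne_zero := Finset.prod_ne_zero_iff.2 fun j _ ↦ pow_ne_zero _ (by exact_mod_cast h0 j)

theorem form_curveForm (hα : α ^ 3 = a) (hω : IsPrimitiveRoot ω 3)
    (hinj : Function.Injective (curveRoot α ω bc)) (h0 : ∀ j, (bc j).1 ≠ 0) {n : ℕ}
    (hn : 3 + m * 2 = n) {R : Type*} [CommRing R] [Algebra ℂ R] (x y : R) :
    (curveForm α ω bc hinj h0 hn).form x y = (x ^ 3 + algebraMap ℂ R a * y ^ 3) *
      ∏ j : Fin m, (algebraMap ℂ R (((bc j).1 : ℂ)) ^ 2 * x ^ 2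
        + algebraMap ℂ R (((bc j).1 : ℂ)) * algebraMap ℂ R (((bc j).2 : ℂ)) * x * y
        + algebraMap ℂ R (((bc j).2 : ℂ)) ^ 2 * y ^ 2) := by
  have hsum : 1 + ω + ω ^ 2 = 0 := by
    have := hω.geom_sum_eq_zero (by norm_num)
    simpa [Finset.sum_range_succ] using this
  have hω3 : ω ^ 3 = 1 := hω.pow_eq_one
  have hs := congr(algebraMap ℂ R $hsum)
  have h3 := congr(algebraMap ℂ R $hω3)
  simp only [map_add, map_pow, map_one, map_zero] at hs h3
  simp only [Polynomial.SplitForm.form, curveForm, Finset.prod_map, Function.Embedding.coeFn_mk,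
    Fintype.prod_sum_type, Fintype.prod_prod_type, map_prod]
  rw [mul_left_comm, ← Finset.prod_mul_distrib]
  congr 1
  · rw [← hα, Fin.prod_univ_three]
    simp only [curveRoot, map_mul, map_pow, map_neg, Fin.val_zero, Fin.val_one, Fin.val_two,
      pow_zero, mul_one, pow_one]
    set A := algebraMap ℂ R α
    set w := algebraMap ℂ R ω
    linear_combination (A * y * x ^ 2 + A ^ 2 * y ^ 2 * w * x) * hs + A ^ 3 * y ^ 3 * h3
  · refine Finset.prod_congr rfl fun j _ ↦ ?_
    have hb : ((bc j).1 : ℂ) ≠ 0 := by exact_mod_cast h0 j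
    have ht := congr(algebraMap ℂ R $(mul_div_cancel₀ ((bc j).2 : ℂ) hb))
    rw [Fin.prod_univ_two]
    simp only [curveRoot, map_mul, map_pow, Fin.val_zero, Fin.val_one] at ht ⊢
    rw [← ht]
    generalize algebraMap ℂ R (((bc j).2 : ℂ) / (bc j).1) = τ
    generalize algebraMap ℂ R ((bc j).1 : ℂ) = b
    set w := algebraMap ℂ R ω
    linear_combination (- b ^ 2 * τ * x * y) * hs + b ^ 2 * τ ^ 2 * y ^ 2 * h3

theorem eq_of_crossRatio_eq {r₁ r₂ r₃ r r' s₁ s₂ s₃ s₄ : ℂ} (h12 : r₁ ≠ r₂) (h23 : r₂ ≠ r₃)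
    (s13 : s₁ ≠ s₃) (s24 : s₂ ≠ s₄)
    (h : (r₁ - r₂) * (r₃ - r) * ((s₁ - s₃) * (s₂ - s₄)) =
      (r₁ - r₃) * (r₂ - r) * ((s₁ - s₂) * (s₃ - s₄)))
    (h' : (r₁ - r₂) * (r₃ - r') * ((s₁ - s₃) * (s₂ - s₄)) =
      (r₁ - r₃) * (r₂ - r') * ((s₁ - s₂) * (s₃ - s₄))) : r = r' := by
  by_contra hne
  have h0 : (r - r') * ((r₁ - r₂) * ((s₁ - s₃) * (s₂ - s₄)) -
      (r₁ - r₃) * ((s₁ - s₂) * (s₃ - s₄))) = 0 := by linear_combination h' - h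
  have h1 := (mul_eq_zero.1 h0).resolve_left (sub_ne_zero.2 hne)
  have h2 : (r₁ - r₂) * ((s₁ - s₃) * (s₂ - s₄)) * (r₃ - r₂) = 0 := by
    linear_combination h - (r₂ - r) * h1
  simp only [mul_eq_zero, sub_eq_zero] at h2
  tauto

namespace Polynomial.SplitForm

variable {n : ℕ} [NeZero n]

/-- A family of forms sharing three roots, with a varying fourth one, has only finitely many
members whose function field is isomorphic to a given one. -/
theorem finite_setOf_nonempty_algEquiv {ι : Type*} (hn : 5 ≤ n) (hodd : Odd n) (B : SplitForm n)
    (A : ι → SplitForm n) {r₁ r₂ r₃ : ℂ} {r : ι → ℂ} (hr : Function.Injective r)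
    (h12 : r₁ ≠ r₂) (h13 : r₁ ≠ r₃) (h23 : r₂ ≠ r₃) (h24 : ∀ i, r₂ ≠ r i)
    (h1 : ∀ i, r₁ ∈ (A i).roots) (h2 : ∀ i, r₂ ∈ (A i).roots) (h3 : ∀ i, r₃ ∈ (A i).roots)
    (h4 : ∀ i, r i ∈ (A i).roots) :
    {i | Nonempty ((A i).FunField ≃ₐ[ℂ] B.FunField)}.Finite := by
  let S : Finset ℂ := B.roots ∪ nthRootsFinset n (1 : ℂ)
  have hS : ∀ s : ℂ, s ∈ B.roots ∨ s ^ n = 1 → s ∈ S := fun s hs ↦ by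
    rw [Finset.mem_union, mem_nthRootsFinset (NeZero.pos n)]
    exact hs
  have key : ∀ i ∈ {i | Nonempty ((A i).FunField ≃ₐ[ℂ] B.FunField)}, ∃ s : ℂ × ℂ × ℂ × ℂ,
      s ∈ S ×ˢ S ×ˢ S ×ˢ S ∧ s.1 ≠ s.2.2.1 ∧ s.2.1 ≠ s.2.2.2 ∧
      (r₁ - r₂) * (r₃ - r i) * ((s.1 - s.2.2.1) * (s.2.1 - s.2.2.2)) =
        (r₁ - r₃) * (r₂ - r i) * ((s.1 - s.2.1) * (s.2.2.1 - s.2.2.2)) := by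
    rintro i ⟨θ⟩
    obtain ⟨σ, hσ, hmem, hc⟩ := exists_crossRatio_eq hn hodd θ
    refine ⟨(σ r₁, σ r₂, σ r₃, σ (r i)), ?_, fun h ↦ h13 (hσ (h1 i) (h3 i) h),
      fun h ↦ h24 i (hσ (h2 i) (h4 i) h), hc _ (h1 i) _ (h2 i) _ (h3 i) _ (h4 i)⟩
    simp only [Finset.mem_product]
    exact ⟨hS _ (hmem _ (h1 i)), hS _ (hmem _ (h2 i)), hS _ (hmem _ (h3 i)), hS _ (hmem _ (h4 i))⟩
  choose! s hs using key
  refine Set.Finite.of_finite_image ((S ×ˢ S ×ˢ S ×ˢ S).finite_toSet.subset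
    (Set.image_subset_iff.2 fun i hi ↦ (hs i hi).1)) (f := s) fun i hi j hj hij ↦ ?_
  obtain ⟨-, e1, e2, e3⟩ := hs i hi
  obtain ⟨-, -, -, e4⟩ := hs j hj
  rw [← hij] at e4
  exact hr (eq_of_crossRatio_eq h12 h23 e1 e2 e3 e4)

end Polynomial.SplitForm

/-- An equivalence relation on an infinite type with finite classes has infinitely many pairwise
inequivalent elements. -/
theorem Setoid.exists_infinite_of_finite_classes {ι : Type*} [Infinite ι] (s : Setoid ι)
    (h : ∀ i, {j | s j i}.Finite) :
    ∃ I : Set ι, I.Infinite ∧ ∀ i ∈ I, ∀ j ∈ I, i ≠ j → ¬ s i j := by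
  refine ⟨Set.range (Quotient.out : Quotient s → ι), ?_, ?_⟩
  · have : Infinite (Quotient s) := by
      by_contra hfin
      rw [not_infinite_iff_finite] at hfin
      refine Set.infinite_univ (α := ι) ?_
      refine (Set.finite_iUnion fun q : Quotient s ↦ h q.out).subset fun i _ ↦ ?_
      exact Set.mem_iUnion.2 ⟨⟦i⟧, s.symm (Quotient.mk_out i)⟩
    exact Set.infinite_range_of_injective Quotient.out_injective
  · rintro _ ⟨p, rfl⟩ _ ⟨q, rfl⟩ hpq hs
    exact hpq (congrArg _ (Quotient.out_equiv_out.1 hs))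

theorem CurvesIsomorphic.refl (f : MvPolynomial (Fin 2) ℂ) : CurvesIsomorphic f f := ⟨.refl⟩

theorem CurvesIsomorphic.symm {f g : MvPolynomial (Fin 2) ℂ} (h : CurvesIsomorphic f g) :
    CurvesIsomorphic g f := h.map .symm

theorem CurvesIsomorphic.trans {f g h : MvPolynomial (Fin 2) ℂ} (hfg : CurvesIsomorphic f g)
    (hgh : CurvesIsomorphic g h) : CurvesIsomorphic f h :=
  Nonempty.map2 AlgEquiv.trans hfg hgh

theorem infinite_setOf_isGoodParam {a : ℤ} {P : Set (ℤ × ℤ)} (hP : P.Infinite)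
    (hPcal : ∀ x ∈ P, ∀ y ∈ P, x ≠ y → x.1 * y.2 ≠ x.2 * y.1) :
    {x ∈ P | IsGoodParam a x}.Infinite := by
  have h1 : {x ∈ P | x.1 = 0}.Subsingleton := fun x hx y hy ↦ by
    by_contra h
    exact hPcal x hx.1 y hy.1 h (by rw [hx.2, hy.2, zero_mul, mul_zero])
  have h2 : {x ∈ P | x.2 = 0}.Subsingleton := fun x hx y hy ↦ by
    by_contra h
    exact hPcal x hx.1 y hy.1 h (by rw [hx.2, hy.2, zero_mul, mul_zero])
  have h3 : {x ∈ P | x.2 ^ 3 + a * x.1 ^ 3 = 0}.Subsingleton := fun x hx y hy ↦ by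
    by_contra h
    refine hPcal x hx.1 y hy.1 h ((Odd.strictMono_pow (by decide : Odd 3)).injective ?_)
    linear_combination x.1 ^ 3 * hy.2 - y.1 ^ 3 * hx.2
  refine (hP.sdiff ((h1.finite.union h2.finite).union h3.finite)).mono fun x hx ↦ ?_
  obtain ⟨hx, hn⟩ := hx
  simp only [Set.mem_union, Set.mem_ofPred_eq, hx, true_and, not_or] at hn
  exact ⟨hx, hn.1.1, hn.1.2, hn.2⟩

/-- **Lemma 4.1** (infinitude of non-isomorphic curves).  Given an infinite set `Pcal` of
nonzero integer vectors `(b, c)` which are pairwise non-proportional, the family of plane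
curves `(X³ + aY³) ∏_j (b_j²X² + b_j c_j XY + c_j²Y²) = Z^n` with all `(b_j, c_j) ∈ Pcal`
contains infinitely many non-singular curves pairwise non-isomorphic over `ℂ`. -/
theorem infinitude_nonisomorphic
    (n : ℕ) (hn5 : 5 ≤ n) (hnodd : Odd n)
    (a : ℤ) (ha : a ≠ 0)
    (Pcal : Set (ℤ × ℤ)) (hPcalinf : Pcal.Infinite)
    (hPcal0 : ∀ x ∈ Pcal, x ≠ (0, 0))
    (hPcal : ∀ x ∈ Pcal, ∀ y ∈ Pcal, x ≠ y → x.1 * y.2 ≠ x.2 * y.1) :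
    ∃ T : Set (Fin ((n - 3) / 2) → ℤ × ℤ),
      T.Infinite ∧
      (∀ v ∈ T, ∀ j, v j ∈ Pcal) ∧
      (∀ v ∈ T, IsNonsingular (curvePoly a n v)) ∧
      (∀ v ∈ T, ∀ w ∈ T, v ≠ w →
        ¬ CurvesIsomorphic (affinePoly a v) (affinePoly a w)) := by
  have : NeZero n := ⟨by omega⟩
  have hnm : 3 + (n - 3) / 2 * 2 = n := by
    obtain ⟨k, rfl⟩ := hnodd
    omega
  have hm : 1 ≤ (n - 3) / 2 := by omega
  generalize (n - 3) / 2 = m at hnm hm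
  obtain ⟨α, hα⟩ := IsAlgClosed.exists_pow_nat_eq (a : ℂ) (by norm_num : 0 < 3)
  obtain ⟨ω, hω⟩ : ∃ ω : ℂ, IsPrimitiveRoot ω 3 :=
    ⟨_, Complex.isPrimitiveRoot_exp 3 (by norm_num)⟩
  have hinf := infinite_setOf_isGoodParam (a := a) hPcalinf hPcal
  let e : ℕ → ℤ × ℤ := fun k ↦ hinf.natEmbedding _ k
  have he : Function.Injective e :=
    Subtype.val_injective.comp (hinf.natEmbedding _).injective
  have hemem : ∀ k, e k ∈ Pcal := fun k ↦ (hinf.natEmbedding _ k).2.1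
  have hegood : ∀ k, IsGoodParam a (e k) := fun k ↦ (hinf.natEmbedding _ k).2.2
  let v : ℕ → Fin m → ℤ × ℤ := fun k j ↦ e (if (j : ℕ) + 1 = m then m + k else j)
  let last : Fin m := ⟨m - 1, by omega⟩
  have hvlast : ∀ k, v k last = e (m + k) := fun k ↦ by
    simp only [v, last]
    rw [if_pos (by omega)]
  have hv : Function.Injective v := fun k l h ↦ by
    have := congr_fun h last
    rw [hvlast, hvlast] at this
    have := he this
    omega
  have hvinj : ∀ k, Function.Injective (v k) := fun k i j h ↦ by
    have := he h
    ext
    split_ifs at this <;> omega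
  have hvpair : ∀ k i j, i ≠ j → (v k i).1 * (v k j).2 ≠ (v k i).2 * (v k j).1 :=
    fun k i j h ↦ hPcal _ (hemem _) _ (hemem _) ((hvinj k).ne h)
  have hinj : ∀ k, Function.Injective (curveRoot α ω (v k)) := fun k ↦
    curveRoot_injective hα ha hω (fun j ↦ hegood _) (hvpair k)
  let A : ℕ → Polynomial.SplitForm n := fun k ↦
    curveForm α ω (v k) (hinj k) (fun j ↦ (hegood _).1) hnm
  have haff : ∀ k, affinePoly a (v k) = (A k).affine := fun k ↦
    congr($(form_curveForm hα hω (hinj k) (fun j ↦ (hegood _).1) hnm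
      (X 0 : MvPolynomial (Fin 2) ℂ) (X 1)) - 1).symm
  have hproj : ∀ k, curvePoly a n (v k) = (A k).proj := fun k ↦
    congr($(form_curveForm hα hω (hinj k) (fun j ↦ (hegood _).1) hnm
      (X 0 : MvPolynomial (Fin 3) ℂ) (X 1)) - X 2 ^ n).symm
  have hroot : ∀ k i, curveRoot α ω (v k) i ∈ (A k).roots := fun k i ↦
    Finset.mem_map_of_mem _ (Finset.mem_univ i)
  have hfin : ∀ l, {k | CurvesIsomorphic (affinePoly a (v k)) (affinePoly a (v l))}.Finite := by
    intro l
    refine (Polynomial.SplitForm.finite_setOf_nonempty_algEquiv hn5 hnodd (A l) A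
      (r₁ := curveRoot α ω (v 0) (.inl 0)) (r₂ := curveRoot α ω (v 0) (.inl 1))
      (r₃ := curveRoot α ω (v 0) (.inl 2)) (r := fun k ↦ curveRoot α ω (v k) (.inr (last, 0)))
      ?_ ((hinj 0).ne (by simp)) ((hinj 0).ne (by simp)) ((hinj 0).ne (by simp))
      (fun k ↦ (hinj k).ne (a₁ := .inl 1) (by simp)) (fun k ↦ hroot k (.inl 0))
      (fun k ↦ hroot k (.inl 1)) (fun k ↦ hroot k (.inl 2)) (fun k ↦ hroot k _)).subset
      fun k hk ↦ ?_
    · intro k l h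
      simp only [curveRoot, hvlast] at h
      have h1 : ((e (m + k)).1 : ℂ) ≠ 0 := by exact_mod_cast (hegood _).1
      have h2 : ((e (m + l)).1 : ℂ) ≠ 0 := by exact_mod_cast (hegood _).1
      have h' := mul_left_cancel₀ (pow_ne_zero _ (hω.ne_zero (by norm_num))) h
      rw [div_eq_div_iff h1 h2] at h'
      by_contra hne
      refine hPcal _ (hemem (m + k)) _ (hemem (m + l)) (he.ne (by omega)) ?_
      have : (e (m + k)).2 * (e (m + l)).1 = (e (m + l)).2 * (e (m + k)).1 := by exact_mod_cast h'
      linear_combination - this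
    · rw [Set.mem_ofPred_eq, haff, haff] at hk
      exact Polynomial.SplitForm.nonempty_algEquiv_of_curvesIsomorphic hk
  obtain ⟨I, hI, hIs⟩ := Setoid.exists_infinite_of_finite_classes
    (⟨fun k l ↦ CurvesIsomorphic (affinePoly a (v k)) (affinePoly a (v l)),
      fun _ ↦ .refl _, .symm, .trans⟩ : Setoid ℕ) hfin
  refine ⟨v '' I, hI.image hv.injOn, ?_, ?_, ?_⟩
  · rintro _ ⟨k, -, rfl⟩ j
    exact hemem _
  · rintro _ ⟨k, -, rfl⟩
    rw [hproj]
    exact (A k).isNonsingular_proj (by omega)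
  · rintro _ ⟨k, hk, rfl⟩ _ ⟨l, hl, rfl⟩ h
    exact hIs k hk l hl fun hkl ↦ h (congrArg v hkl)
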